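/- arXiv:2504.16486 — 2 statements merged into one kernel-verified Lean document; each statement's English description precedes it below -/
import Mathlib

section
/- There exist constants C ≥ c > 0, independent of all the data below, with the following property. Let m ≥ 1 be an integer, σ ∈ [0, 1], and μ ∈ [m, m+1]. Let v be continuous on the closed rectangle [0, π/m] × [−π/2, π/2], vanishing on its boundary and on the slit {(θ, 0) : 0 ≤ θ ≤ σπ/m}, positive on Ω_{m,σ}, C² on Ω_{m,σ}, and satisfying ∂²_φ v − tan(φ)·∂_φ v + (cos φ)^{−2}·∂²_θ v + μ(μ+1)·v = 0 on Ω_{m,σ}. Let a ∈ (0, π/2], let Ω' := {(θ, φ) : 0 < θ < π/m, −a < φ < π/2}, and let V be bounded, continuous up to the boundary of Ω', positive on Ω', vanishing on {θ = 0} ∪ {θ = π/m} ∪ {φ = −a}, C² on Ω', and satisfying the same equation on Ω'. Assume the normalizations ∫₀^π v(x/m, 1/m)·sin(x) dx = π/2 and ∫₀^π V(x/m, 1/m)·sin(x) dx = π/2. Then there exists a real number l with c ≤ l ≤ C such that |v(θ, φ)/V(θ, φ) − l| ≤ C·e^{−c·m·φ} for every (θ, φ) ∈ Ω_{m,σ}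 with φ ≥ 1/m. -/
open Real Set Filter

/-- Partial derivative in the first variable of a function on the plane. -/
noncomputable def pdx (f : ℝ × ℝ → ℝ) (p : ℝ × ℝ) : ℝ := fderiv ℝ f p (1, 0)

/-- Partial derivative in the second variable of a function on the plane. -/
noncomputable def pdy (f : ℝ × ℝ → ℝ) (p : ℝ × ℝ) : ℝ := fderiv ℝ f p (0, 1)

/-- The closed spherical rectangle `[0, π/m] × [-π/2, π/2]` in `(θ, φ)` coordinates. -/
def RectSet (m : ℕ) : Set (ℝ × ℝ) :=
  Set.Icc (0 : ℝ) (π / m) ×ˢ Set.Icc (-(π / 2)) (π / 2)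

/-- The slit spherical rectangle
`Ω_{m,σ} = (0, π/m) × (-π/2, π/2) \ {(θ, 0) : 0 ≤ θ ≤ σπ/m}`. -/
def OmegaSet (m : ℕ) (σ : ℝ) : Set (ℝ × ℝ) :=
  (Set.Ioo (0 : ℝ) (π / m) ×ˢ Set.Ioo (-(π / 2)) (π / 2)) \
    {p : ℝ × ℝ | 0 ≤ p.1 ∧ p.1 ≤ σ * π / m ∧ p.2 = 0}

/-- `v` is an eigenfunction on the slit spherical rectangle `Ω_{m,σ}` with eigenvalue
`μ(μ+1)`: continuous on the closed rectangle, vanishing on its boundary and on the slit,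
`C²` on `Ω_{m,σ}` and solving
`∂²_φ v - tan(φ)·∂_φ v + (cos φ)⁻²·∂²_θ v + μ(μ+1)·v = 0` there. -/
def SphEigen (m : ℕ) (σ μ : ℝ) (v : ℝ × ℝ → ℝ) : Prop :=
  ContinuousOn v (RectSet m) ∧
  (∀ p ∈ RectSet m, (p.1 = 0 ∨ p.1 = π / m ∨ p.2 = -(π / 2) ∨ p.2 = π / 2) → v p = 0) ∧
  (∀ θ : ℝ, 0 ≤ θ → θ ≤ σ * π / m → v (θ, 0) = 0) ∧
  ContDiffOn ℝ 2 v (OmegaSet m σ) ∧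
  (∀ p ∈ OmegaSet m σ,
    pdy (pdy v) p - Real.tan p.2 * pdy v p + pdx (pdx v) p / Real.cos p.2 ^ 2
      + μ * (μ + 1) * v p = 0)

/-- The spherical sector `Ω' = (0, π/m) × (-a, π/2)` in `(θ, φ)` coordinates. -/
def OmegaPrime (m : ℕ) (a : ℝ) : Set (ℝ × ℝ) :=
  Set.Ioo (0 : ℝ) (π / m) ×ˢ Set.Ioo (-a) (π / 2)

namespace BH

lemma growth {F F' : ℝ → ℝ} (h : ∀ s, 0 < s → HasDerivAt F (F' s) s) {a b c : ℝ}
    (ha : 0 < a) (hab : a ≤ b) (hc : ∀ s, a ≤ s → s ≤ b → c ≤ F' s) :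
    F a + c * (b - a) ≤ F b := by
  rcases hab.eq_or_lt with rfl | hab
  · simp
  obtain ⟨x, hx, hx2⟩ := exists_hasDerivAt_eq_slope F F' hab
    (fun s hs => (h s (lt_of_lt_of_le ha hs.1)).continuousAt.continuousWithinAt)
    (fun s hs => h s (ha.trans hs.1))
  have h1 := hc x hx.1.le hx.2.le
  rw [hx2, le_div_iff₀ (by linarith)] at h1
  linarith

/-- A positive solution of the mode equation on a half line decays at most exponentially. -/
lemma riccati {Q f f' : ℝ → ℝ} (hQ : ∀ s, 0 ≤ Q s) (hf : ∀ s, 0 < s → 0 < f s)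
    (h1 : ∀ s, 0 < s → HasDerivAt f (f' s) s)
    (h2 : ∀ s, 0 < s → HasDerivAt f' ((1 - Q s) * f s) s) (s : ℝ) (hs : 0 < s) :
    0 ≤ f' s + f s := by
  by_contra hneg
  push Not at hneg
  set e := -((f' s + f s) * exp (-s)) with he
  have hepos : 0 < e := by
    have := exp_pos (-s)
    rw [he]; nlinarith
  have hd : ∀ t, 0 < t → HasDerivAt (fun t => -((f' t + f t) * exp (-t)))
      (Q t * f t * exp (-t)) t := by
    intro t ht
    have h3 : HasDerivAt (fun t => exp (-t)) (exp (-t) * (-1)) t := (hasDerivAt_neg t).exp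
    refine (((h2 t ht).add (h1 t ht)).mul h3).neg.congr_deriv ?_
    simp only [Pi.add_apply]
    ring
  have hb : ∀ t, s ≤ t → f' t + f t ≤ -e := by
    intro t hst
    have := growth hd (c := 0) hs hst (fun r hr _ => by
      have := hf r (hs.trans_le hr); have := hQ r; positivity)
    have h4 : exp (-t) ≤ 1 := by rw [exp_le_one_iff]; linarith
    have h5 := exp_pos (-t)
    simp only [zero_mul, add_zero] at this
    have h6 : e ≤ -(f' t + f t) * exp (-t) := by rw [he]; linarith
    have h7 : 0 < -(f' t + f t) := by
      by_contra hh
      push Not at hh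
      nlinarith
    nlinarith
  have h8 := growth (F := fun t => - f t) (F' := fun t => - f' t) (fun t ht => (h1 t ht).neg)
    (c := e) hs (show s ≤ s + f s / e by have := div_pos (hf s hs) hepos; linarith)
    (fun r hr _ => by have := hb r hr; have := hf r (hs.trans_le hr); linarith)
  have h9 := hf (s + f s / e) (by have := div_pos (hf s hs) hepos; linarith)
  have : e * (s + f s / e - s) = f s := by field_simp; ring
  linarith

lemma wronski_aux {Q f f' g g' : ℝ → ℝ} {B : ℝ}
    (hf : ∀ s, 0 < s → 0 < f s) (hg : ∀ s, 0 < s → 0 < g s)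
    (hgB : ∀ s, 0 < s → g s ≤ B)
    (f1 : ∀ s, 0 < s → HasDerivAt f (f' s) s)
    (f2 : ∀ s, 0 < s → HasDerivAt f' ((1 - Q s) * f s) s)
    (g1 : ∀ s, 0 < s → HasDerivAt g (g' s) s)
    (g2 : ∀ s, 0 < s → HasDerivAt g' ((1 - Q s) * g s) s) (s : ℝ) (hs : 0 < s) :
    f s * g' s - g s * f' s ≤ 0 := by
  by_contra hW
  push Not at hW
  set W := f s * g' s - g s * f' s with hWdef
  have hd : ∀ t, 0 < t → HasDerivAt (fun t => f t * g' t - g t * f' t) 0 t := by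
    intro t ht
    refine (((f1 t ht).mul (g2 t ht)).sub ((g1 t ht).mul (f2 t ht))).congr_deriv ?_
    ring
  have hW2 : ∀ t, s ≤ t → W ≤ f t * g' t - g t * f' t := by
    intro t ht
    have := growth hd (c := 0) hs ht (fun _ _ _ => le_rfl)
    rw [hWdef]; linarith
  have hB : 0 < B := (hg s hs).trans_le (hgB s hs)
  have hq : ∀ t, 0 < t → HasDerivAt (fun t => -(f t / g t))
      ((f t * g' t - g t * f' t) / (g t)^2) t := by
    intro t ht
    have := hg t ht
    refine ((f1 t ht).div (g1 t ht) this.ne').neg.congr_deriv ?_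
    ring
  set c := W / B^2 with hc
  have hcpos : 0 < c := by positivity
  have hr : 0 < f s / g s := div_pos (hf s hs) (hg s hs)
  have hlt : s ≤ s + (f s / g s) / c := by have := div_pos hr hcpos; linarith
  have h8 := growth hq (c := c) hs hlt (fun r hr _ => by
    have h1 := hW2 r hr
    have h2 := hg r (hs.trans_le hr)
    have h3 := hgB r (hs.trans_le hr)
    rw [hc]
    have h4 : 0 ≤ f r * g' r - g r * f' r := hW.le.trans h1
    gcongr)
  have h9 := div_pos (hf _ (hs.trans_le hlt)) (hg _ (hs.trans_le hlt))
  have : c * (s + (f s / g s) / c - s) = f s / g s := by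
    rw [add_sub_cancel_left]; field_simp
  linarith

lemma wronski {Q f f' g g' : ℝ → ℝ} {B : ℝ}
    (hf : ∀ s, 0 < s → 0 < f s) (hg : ∀ s, 0 < s → 0 < g s)
    (hfB : ∀ s, 0 < s → f s ≤ B) (hgB : ∀ s, 0 < s → g s ≤ B)
    (f1 : ∀ s, 0 < s → HasDerivAt f (f' s) s)
    (f2 : ∀ s, 0 < s → HasDerivAt f' ((1 - Q s) * f s) s)
    (g1 : ∀ s, 0 < s → HasDerivAt g (g' s) s)
    (g2 : ∀ s, 0 < s → HasDerivAt g' ((1 - Q s) * g s) s) (s₁ : ℝ) (hs₁ : 0 < s₁)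
    (heq : f s₁ = g s₁) (s : ℝ) (hs : 0 < s) : f s = g s := by
  have hW : ∀ t, 0 < t → f t * g' t - g t * f' t = 0 := fun t ht => by
    have h1 := wronski_aux hf hg hgB f1 f2 g1 g2 t ht
    have h2 := wronski_aux hg hf hfB g1 g2 f1 f2 t ht
    linarith
  have hq : ∀ t, 0 < t → HasDerivAt (fun t => -(f t / g t)) 0 t := by
    intro t ht
    have := hg t ht
    refine ((f1 t ht).div (g1 t ht) this.ne').neg.congr_deriv ?_
    rw [show f' t * g t - f t * g' t = -(f t * g' t - g t * f' t) by ring, hW t ht]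
    simp
  have hq' : ∀ t, 0 < t → HasDerivAt (fun t => (f t / g t)) 0 t := by
    intro t ht
    refine ((f1 t ht).div (g1 t ht) (hg t ht).ne').congr_deriv ?_
    rw [show f' t * g t - f t * g' t = -(f t * g' t - g t * f' t) by ring, hW t ht]
    simp
  have key : ∀ a b, 0 < a → a ≤ b → f a / g a = f b / g b := by
    intro a b ha hab
    have h1 := growth hq (c := 0) ha hab (fun _ _ _ => le_rfl)
    have h2 := growth hq' (c := 0) ha hab (fun _ _ _ => le_rfl)
    linarith
  have h1 : f s / g s = f s₁ / g s₁ := by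
    rcases le_total s s₁ with h | h
    · exact key _ _ hs h
    · exact (key _ _ hs₁ h).symm
  rw [heq, div_self (hg s₁ hs₁).ne', div_eq_one_iff_eq (hg s hs).ne'] at h1
  exact h1

/-- Decay of the higher modes relative to the first one. -/
lemma decay {Q f f' w w' : ℝ → ℝ} {κ M : ℝ} (hκ : 1 ≤ κ) (hQ : ∀ s, 0 ≤ Q s)
    (hf : ∀ s, 0 < s → 0 < f s) (hf0 : Tendsto f atTop (nhds 0))
    (f1 : ∀ s, 0 < s → HasDerivAt f (f' s) s)
    (f2 : ∀ s, 0 < s → HasDerivAt f' ((1 - Q s) * f s) s)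
    (w1 : ∀ s, 0 < s → HasDerivAt w (w' s) s)
    (w2 : ∀ s, 0 < s → HasDerivAt w' ((κ^2 - Q s) * w s) s)
    (hw : ∀ s, 0 < s → |w s| ≤ M * f s) (s : ℝ) (hs : 0 < s) :
    |w s| ≤ M * exp (-(κ - 1) * s) * f s := by
  set α := κ - 1 with hα
  have hα0 : 0 ≤ α := by linarith
  have hM : 0 ≤ M := by
    have := hw 1 one_pos; have := abs_nonneg (w 1); have := hf 1 one_pos
    by_contra hh
    push Not at hh
    nlinarith
  have hric := riccati hQ hf f1 f2
  -- the monotone quantity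
  set D : ℝ → ℝ := fun t => w t * w' t + (α - f' t / f t) * w t ^ 2 with hD
  have hDd : ∀ t, 0 < t → HasDerivAt D ((w' t + (α - f' t / f t) * w t)^2
      + 2 * α * ((f' t + f t) / f t) * w t ^ 2) t := by
    intro t ht
    have hft := hf t ht
    have := ((w1 t ht).mul (w2 t ht)).add ((((f2 t ht).div (f1 t ht) hft.ne').const_sub α).mul
      ((w1 t ht).pow 2))
    refine this.congr_deriv ?_
    have hκα : κ = α + 1 := by rw [hα]; ring
    rw [hκα]
    simp only [Pi.div_apply, Pi.pow_apply, Nat.reduceSub, pow_one, Nat.cast_ofNat]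
    field_simp
    ring
  have hDnn : ∀ t, 0 < t → 0 ≤ (w' t + (α - f' t / f t) * w t)^2
      + 2 * α * ((f' t + f t) / f t) * w t ^ 2 := by
    intro t ht
    have := hric t ht
    have := hf t ht
    positivity
  have hDle : ∀ t, 0 < t → D t ≤ 0 := by
    intro t ht
    by_contra hpos
    push Not at hpos
    set c := D t with hc
    have hmono : ∀ r, t ≤ r → c ≤ D r := by
      intro r hr
      have := growth hDd (c := 0) ht hr (fun q hq _ => hDnn q (ht.trans_le hq))
      simpa using this
    -- w tends to zero
    have hw0 : Tendsto (fun r => (α + 1) * (M * f r)^2) atTop (nhds 0) := by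
      have := ((hf0.const_mul M).pow 2).const_mul (α + 1)
      simpa using this
    obtain ⟨R, hR⟩ := eventually_atTop.1 (hw0.eventually (gt_mem_nhds (show 0 < c / 2 by linarith)))
    set a := max t R with ha
    have hat : t ≤ a := le_max_left _ _
    have hwa : ∀ r, a ≤ r → (α + 1) * w r ^ 2 ≤ c / 2 := by
      intro r hr
      have h1 := hR r ((le_max_right _ _).trans hr)
      have h2 := hw r (by linarith)
      have h3 : w r ^ 2 ≤ (M * f r)^2 := sq_le_sq' (by linarith [neg_abs_le (w r)])
        (by linarith [le_abs_self (w r)])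
      nlinarith
    have hsq : ∀ r, 0 < r → HasDerivAt (fun r => w r ^ 2) (2 * (w r * w' r)) r := by
      intro r hr
      refine ((w1 r hr).pow 2).congr_deriv ?_
      push_cast
      ring
    have hgr : ∀ r, a ≤ r → c ≤ 2 * (w r * w' r) := by
      intro r hr
      have h1 := hmono r (hat.trans hr)
      have h2 := hwa r hr
      have hr0 : 0 < r := by linarith
      have h3 : - (f' r / f r) ≤ 1 := by
        have := hric r hr0
        have h4 := hf r hr0
        rw [← neg_div, div_le_one h4]
        linarith
      have h5 : (α - f' r / f r) * w r ^ 2 ≤ (α + 1) * w r ^ 2 := by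
        gcongr
        linarith
      simp only [hD] at h1
      linarith
    have hfin := growth hsq (c := c) (show 0 < a by linarith) (show a ≤ a + 1 by linarith)
      (fun r hr _ => hgr r hr)
    have h1 := hwa (a + 1) (by linarith)
    have h2 := sq_nonneg (w a)
    have h3 := sq_nonneg (w (a+1))
    nlinarith
  -- monotonicity of the weighted quotient
  have hp : ∀ t, 0 < t → HasDerivAt (fun t => -(exp (α * t) * w t / f t)^2)
      (-(2 * exp (α * t)^2 * D t / f t ^ 2)) t := by
    intro t ht
    have hft := hf t ht
    have he : HasDerivAt (fun t => exp (α * t)) (exp (α * t) * α) t := by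
      simpa using ((hasDerivAt_id t).const_mul α).exp
    refine (((he.mul (w1 t ht)).div (f1 t ht) hft.ne').pow 2).neg.congr_deriv ?_
    simp only [hD, Pi.mul_apply, Pi.div_apply, Nat.reduceSub, pow_one, Nat.cast_ofNat]
    field_simp
    ring
  have hkey : ∀ a, 0 < a → a ≤ s → exp (α * s) * |w s| / f s ≤ exp (α * a) * M := by
    intro a ha has
    have h1 := growth hp (c := 0) ha has (fun r hr _ => by
      have h2 := hDle r (ha.trans_le hr)
      have h3 : 2 * exp (α * r)^2 * D r / f r ^ 2 ≤ 0 := by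
        apply div_nonpos_of_nonpos_of_nonneg _ (by positivity)
        apply mul_nonpos_of_nonneg_of_nonpos (by positivity) h2
      linarith)
    have h2 : (exp (α * s) * w s / f s)^2 ≤ (exp (α * a) * w a / f a)^2 := by linarith
    have h3 := sq_le_sq.1 h2
    have hfs := hf s hs
    have hfa := hf a ha
    rw [abs_div, abs_div, abs_mul, abs_mul, abs_exp, abs_exp, abs_of_pos hfs, abs_of_pos hfa] at h3
    refine h3.trans ?_
    rw [div_le_iff₀ hfa, mul_assoc]
    gcongr
    exact hw a ha
  have hlim : exp (α * s) * |w s| / f s ≤ M := by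
    have ht : Tendsto (fun a => exp (α * a) * M) (nhdsWithin 0 (Ioi 0)) (nhds M) := by
      have : ContinuousAt (fun a => exp (α * a) * M) 0 := by fun_prop
      have h2 := this.tendsto
      simp only [mul_zero, exp_zero, one_mul] at h2
      exact h2.mono_left nhdsWithin_le_nhds
    refine ge_of_tendsto ht ?_
    filter_upwards [Ioo_mem_nhdsGT hs] with a ha
    exact hkey a ha.1 ha.2.le
  have hfs := hf s hs
  rw [div_le_iff₀ hfs] at hlim
  have h5 : exp (-α * s) * exp (α * s) = 1 := by rw [← exp_add]; simp
  calc |w s| = exp (-α * s) * (exp (α * s) * |w s|) := by rw [← mul_assoc, h5, one_mul]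
    _ ≤ exp (-α * s) * (M * f s) := by gcongr
    _ = _ := by ring

lemma limit_ode {F F' F2 : ℕ → ℝ → ℝ} {U G : ℝ → ℝ} {B : ℝ}
    (h1 : ∀ n s, 0 < s → HasDerivAt (F n) (F' n s) s)
    (h2 : ∀ n s, 0 < s → HasDerivAt (F' n) (F2 n s) s)
    (hc : ∀ n, ContinuousOn (F2 n) (Ioi 0))
    (hU : ∀ s, 0 < s → Tendsto (fun n => F n s) atTop (nhds (U s)))
    (hG : ∀ s, 0 < s → Tendsto (fun n => F2 n s) atTop (nhds (G s)))
    (hb : ∀ n s, 0 < s → |F2 n s| ≤ B)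
    (hGc : ContinuousOn G (Ioi 0)) :
    ∃ d : ℝ → ℝ, ∀ s, 0 < s → HasDerivAt U (d s) s ∧ HasDerivAt d (G s) s := by
  have hsub : ∀ s, 0 < s → uIcc 1 s ⊆ Ioi (0:ℝ) := fun s hs t ht =>
    lt_of_lt_of_le (lt_min one_pos hs) ht.1
  have taylor : ∀ n s, 0 < s →
      F n s = F n 1 + F' n 1 * (s - 1) + ∫ τ in (1:ℝ)..s, (s - τ) * F2 n τ := by
    intro n s hs
    have : ∫ τ in (1:ℝ)..s, (s - τ) * F2 n τ =
        (F n s + (s - s) * F' n s) - (F n 1 + (s - 1) * F' n 1) := by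
      apply intervalIntegral.integral_eq_sub_of_hasDerivAt
        (f := fun τ => F n τ + (s - τ) * F' n τ)
      · intro τ hτ
        have hτ0 := hsub s hs hτ
        refine ((h1 n τ hτ0).add (((hasDerivAt_id τ).const_sub s).mul (h2 n τ hτ0))).congr_deriv ?_
        simp
      · apply ContinuousOn.intervalIntegrable
        exact (by fun_prop : Continuous fun τ : ℝ => s - τ).continuousOn.mul ((hc n).mono (hsub s hs))
    rw [this]; ring
  have hlimI : ∀ s, 0 < s → Tendsto (fun n => ∫ τ in (1:ℝ)..s, (s - τ) * F2 n τ) atTop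
      (nhds (∫ τ in (1:ℝ)..s, (s - τ) * G τ)) := by
    intro s hs
    apply intervalIntegral.tendsto_integral_filter_of_dominated_convergence
      (fun τ => |s - τ| * B)
    · refine Eventually.of_forall fun n => ?_
      apply ContinuousOn.aestronglyMeasurable _ measurableSet_uIoc
      exact (by fun_prop : Continuous fun τ : ℝ => s - τ).continuousOn.mul
        ((hc n).mono (uIoc_subset_uIcc.trans (hsub s hs)))
    · refine Eventually.of_forall fun n => Eventually.of_forall fun τ hτ => ?_
      rw [norm_mul, norm_eq_abs, norm_eq_abs]
      gcongr
      exact hb n τ (hsub s hs (uIoc_subset_uIcc hτ))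
    · exact (by fun_prop : Continuous fun τ : ℝ => |s - τ| * B).intervalIntegrable _ _
    · refine Eventually.of_forall fun τ hτ => ?_
      exact (hG τ (hsub s hs (uIoc_subset_uIcc hτ))).const_mul _
  obtain ⟨b, hbl⟩ : ∃ b, Tendsto (fun n => F' n 1) atTop (nhds b) := by
    refine ⟨U 2 - U 1 - ∫ τ in (1:ℝ)..2, (2 - τ) * G τ, ?_⟩
    refine (((hU 2 two_pos).sub (hU 1 one_pos)).sub (hlimI 2 two_pos)).congr fun n => ?_
    rw [taylor n 2 two_pos]; ring
  have hrep : ∀ s, 0 < s → U s = U 1 + b * (s - 1) + ∫ τ in (1:ℝ)..s, (s - τ) * G τ := by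
    intro s hs
    refine tendsto_nhds_unique (hU s hs) ?_
    refine (((hU 1 one_pos).add (hbl.mul_const (s - 1))).add (hlimI s hs)).congr fun n => ?_
    rw [← taylor n s hs]
  have hint : ∀ s, 0 < s → IntervalIntegrable G MeasureTheory.volume 1 s := fun s hs =>
    ((hGc.mono (hsub s hs))).intervalIntegrable
  have hGt : ContinuousOn (fun τ => τ * G τ) (Ioi 0) := continuousOn_id.mul hGc
  have hint2 : ∀ s, 0 < s → IntervalIntegrable (fun τ => τ * G τ) MeasureTheory.volume 1 s :=
    fun s hs => ((hGt.mono (hsub s hs))).intervalIntegrable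
  have hftc : ∀ H : ℝ → ℝ, ContinuousOn H (Ioi 0) → ∀ s, 0 < s →
      HasDerivAt (fun s => ∫ τ in (1:ℝ)..s, H τ) (H s) s := by
    intro H hH s hs
    have hn : Ioi (0:ℝ) ∈ nhds s := Ioi_mem_nhds hs
    apply intervalIntegral.integral_hasDerivAt_right
    · exact ((hH.mono (hsub s hs))).intervalIntegrable
    · exact hH.stronglyMeasurableAtFilter isOpen_Ioi s hs
    · exact hH.continuousAt hn
  refine ⟨fun s => b + ∫ τ in (1:ℝ)..s, G τ, fun s hs => ⟨?_, ?_⟩⟩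
  · have e : (fun s => U 1 + b * (s - 1) + (s * (∫ τ in (1:ℝ)..s, G τ)
        - ∫ τ in (1:ℝ)..s, τ * G τ)) =ᶠ[nhds s] U := by
      filter_upwards [Ioi_mem_nhds hs] with r hr
      rw [hrep r hr]
      congr 1
      rw [← intervalIntegral.integral_const_mul, ← intervalIntegral.integral_sub
        ((hint r hr).const_mul _) (hint2 r hr)]
      congr 1; ext τ; ring
    refine HasDerivAt.congr_of_eventuallyEq ?_ e.symm
    have h3 := (((hasDerivAt_id s).sub_const 1).const_mul b).const_add (U 1)
    refine (h3.add (((hasDerivAt_id s).mul (hftc G hGc s hs)).sub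
      (hftc _ hGt s hs))).congr_deriv ?_
    simp
  · exact (hftc G hGc s hs).const_add b

lemma param_deriv {h hs : ℝ × ℝ → ℝ}
    (hc : ContinuousOn h (Ioo 0 π ×ˢ Ioi 0)) (hcs : ContinuousOn hs (Ioo 0 π ×ˢ Ioi 0))
    (hd : ∀ x ∈ Ioo 0 π, ∀ s, 0 < s → HasDerivAt (fun s => h (x, s)) (hs (x, s)) s)
    {l ψ : ℝ → ℝ} (hl : Continuous l) (hm : ∀ y ∈ Icc 0 π, l y ∈ Ioo 0 π) (hψ : Continuous ψ)
    (s : ℝ) (hs0 : 0 < s) :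
    HasDerivAt (fun s => ∫ y in (0:ℝ)..π, h (l y, s) * ψ y)
      (∫ y in (0:ℝ)..π, hs (l y, s) * ψ y) s := by
  have hπ := pi_pos
  have hu : uIcc 0 π = Icc 0 π := uIcc_of_le hπ.le
  have hline : ∀ g : ℝ × ℝ → ℝ, ContinuousOn g (Ioo 0 π ×ˢ Ioi 0) → ∀ r, 0 < r →
      ContinuousOn (fun y => g (l y, r) * ψ y) (uIcc 0 π) := by
    intro g hg r hr
    refine ContinuousOn.mul (hg.comp (by fun_prop) ?_) hψ.continuousOn
    intro y hy
    rw [hu] at hy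
    exact ⟨hm y hy, hr⟩
  set K : Set (ℝ × ℝ) := Icc 0 π ×ˢ Icc (s/2) (2*s) with hK
  have hKc : IsCompact K := isCompact_Icc.prod isCompact_Icc
  have hcK : ContinuousOn (fun p : ℝ × ℝ => hs (l p.1, p.2) * ψ p.1) K := by
    refine ContinuousOn.mul (hcs.comp (by fun_prop) ?_) (by fun_prop)
    rintro ⟨y, r⟩ ⟨hy, hr⟩
    exact ⟨hm y hy, lt_of_lt_of_le (by linarith : 0 < s/2) hr.1⟩
  obtain ⟨C, hC⟩ := hKc.exists_bound_of_continuousOn hcK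
  refine (intervalIntegral.hasDerivAt_integral_of_dominated_loc_of_deriv_le
    (F := fun r y => h (l y, r) * ψ y) (F' := fun r y => hs (l y, r) * ψ y)
    (s := Icc (s/2) (2*s)) (bound := fun _ => C)
    (Icc_mem_nhds (by linarith) (by linarith)) ?_ ?_ ?_ ?_ ?_ ?_).2
  · filter_upwards [Ioi_mem_nhds hs0] with r hr
    exact ((hline h hc r hr).mono uIoc_subset_uIcc).aestronglyMeasurable measurableSet_uIoc
  · exact (hline h hc s hs0).intervalIntegrable
  · exact ((hline hs hcs s hs0).mono uIoc_subset_uIcc).aestronglyMeasurable measurableSet_uIoc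
  · refine Eventually.of_forall fun y hy r hr => ?_
    have hy' := uIoc_subset_uIcc hy
    rw [hu] at hy'
    exact hC (y, r) ⟨hy', hr⟩
  · exact intervalIntegrable_const
  · refine Eventually.of_forall fun y hy r hr => ?_
    have hy' := uIoc_subset_uIcc hy
    rw [hu] at hy'
    exact (hd (l y) (hm y hy') r (lt_of_lt_of_le (by linarith : 0 < s/2) hr.1)).mul_const _

/-- Positive bounded solutions on the half strip, with explicit partial derivatives. -/
structure Good (Q : ℝ → ℝ) (u us uss ux uxx : ℝ × ℝ → ℝ) : Prop where
  cont : ContinuousOn u (Icc 0 π ×ˢ Ioi 0)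
  left : ∀ s, 0 < s → u (0, s) = 0
  right : ∀ s, 0 < s → u (π, s) = 0
  pos : ∀ x ∈ Ioo 0 π, ∀ s, 0 < s → 0 < u (x, s)
  ds : ∀ x ∈ Ioo 0 π, ∀ s, 0 < s → HasDerivAt (fun s => u (x, s)) (us (x, s)) s
  dss : ∀ x ∈ Ioo 0 π, ∀ s, 0 < s → HasDerivAt (fun s => us (x, s)) (uss (x, s)) s
  dx : ∀ x ∈ Ioo 0 π, ∀ s, 0 < s → HasDerivAt (fun x => u (x, s)) (ux (x, s)) x
  dxx : ∀ x ∈ Ioo 0 π, ∀ s, 0 < s → HasDerivAt (fun x => ux (x, s)) (uxx (x, s)) x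
  cs : ContinuousOn us (Ioo 0 π ×ˢ Ioi 0)
  css : ContinuousOn uss (Ioo 0 π ×ˢ Ioi 0)
  pde : ∀ x ∈ Ioo 0 π, ∀ s, 0 < s → uss (x, s) + uxx (x, s) + Q s * u (x, s) = 0
  bdd : ∃ B, ∀ x ∈ Icc 0 π, ∀ s, 0 < s → |u (x, s)| ≤ B

/-- Sine modes. -/
noncomputable def mode (u : ℝ × ℝ → ℝ) (k : ℕ) (s : ℝ) : ℝ :=
  ∫ y in (0:ℝ)..π, u (y, s) * sin (k * y)

variable {Q : ℝ → ℝ} {u us uss ux uxx : ℝ × ℝ → ℝ}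

lemma Good.contx (h : Good Q u us uss ux uxx) {s : ℝ} (hs : 0 < s) :
    ContinuousOn (fun x => u (x, s)) (Icc 0 π) :=
  h.cont.comp (by fun_prop) (fun _ hx => ⟨hx, hs⟩)

lemma Good.mode_cont (h : Good Q u us uss ux uxx) (k : ℕ) : ContinuousOn (mode u k) (Ioi 0) := by
  obtain ⟨B, hB⟩ := h.bdd
  have hu : uIcc 0 π = Icc 0 π := uIcc_of_le pi_pos.le
  intro s hs
  apply intervalIntegral.continuousWithinAt_of_dominated_interval (bound := fun _ => B)
  · filter_upwards [self_mem_nhdsWithin] with r hr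
    apply ContinuousOn.aestronglyMeasurable _ measurableSet_uIoc
    refine ContinuousOn.mono ?_ uIoc_subset_uIcc
    rw [hu]
    exact (h.contx hr).mul (by fun_prop)
  · filter_upwards [self_mem_nhdsWithin] with r hr
    refine Eventually.of_forall fun y hy => ?_
    have hy' := uIoc_subset_uIcc hy
    rw [hu] at hy'
    rw [norm_mul, norm_eq_abs, norm_eq_abs]
    have h1 := hB y hy' r hr
    have h2 := abs_sin_le_one (k * y)
    have h3 := abs_nonneg (u (y, r))
    have h4 := abs_nonneg (sin (k * y))
    nlinarith
  · exact intervalIntegrable_const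
  · refine Eventually.of_forall fun y hy => ?_
    have hy' := uIoc_subset_uIcc hy
    rw [hu] at hy'
    refine ContinuousWithinAt.mul ?_ continuousWithinAt_const
    exact (h.cont (y, s) ⟨hy', hs⟩).comp (t := Icc 0 π ×ˢ Ioi 0) (by fun_prop) (fun r hr => ⟨hy', hr⟩)

lemma Good.mode_ode (h : Good Q u us uss ux uxx) {A : ℝ} (hQc : Continuous Q)
    (hQ0 : ∀ s, 0 ≤ Q s) (hQA : ∀ s, Q s ≤ A) (k : ℕ) :
    ∃ d : ℝ → ℝ, ∀ s, 0 < s → HasDerivAt (mode u k) (d s) s ∧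
      HasDerivAt d (((k:ℝ)^2 - Q s) * mode u k s) s := by
  obtain ⟨B, hB⟩ := h.bdd
  have hπ := pi_pos
  have hB0 : 0 ≤ B := (abs_nonneg _).trans (hB 0 ⟨le_rfl, hπ.le⟩ 1 one_pos)
  have hu : uIcc 0 π = Icc 0 π := uIcc_of_le hπ.le
  have hA0 : 0 ≤ A := (hQ0 0).trans (hQA 0)
  set lam : ℕ → ℝ := fun n => 1 - 1 / ((n:ℝ) + 2) with hlam
  have hl1 : ∀ n, lam n < 1 := fun n => by
    have : (0:ℝ) < 1 / ((n:ℝ) + 2) := by positivity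
    simp only [hlam]; linarith
  have hl2 : ∀ n, 1/2 ≤ lam n := fun n => by
    have : 1 / ((n:ℝ) + 2) ≤ 1 / 2 := by
      apply one_div_le_one_div_of_le two_pos
      have : (0:ℝ) ≤ n := n.cast_nonneg
      linarith
    simp only [hlam]; linarith
  have hltend : Tendsto lam atTop (nhds 1) := by
    have h1 : Tendsto (fun n : ℕ => 1 / ((n:ℝ) + 2)) atTop (nhds 0) := by
      refine tendsto_const_nhds.div_atTop ?_
      exact tendsto_atTop_add_const_right _ _ tendsto_natCast_atTop_atTop
    have h2 := h1.const_sub 1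
    rw [sub_zero] at h2
    exact h2
  set l : ℕ → ℝ → ℝ := fun n y => π/2 + lam n * (y - π/2) with hl
  have hlc : ∀ n, Continuous (l n) := fun n => by simp only [hl]; fun_prop
  have hlm : ∀ n, ∀ y ∈ Icc 0 π, l n y ∈ Ioo 0 π := by
    intro n y hy
    have h1 := hl1 n; have h2 := hl2 n
    have h3 := hy.1; have h4 := hy.2
    constructor <;> simp only [hl] <;> nlinarith
  have hlt : ∀ y, Tendsto (fun n => l n y) atTop (nhds y) := by
    intro y
    have := (hltend.mul_const (y - π/2)).const_add (π/2)
    simpa using this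
  have hut : ∀ y ∈ Icc 0 π, ∀ s, 0 < s → Tendsto (fun n => u (l n y, s)) atTop (nhds (u (y, s))) := by
    intro y hy s hs
    refine (h.contx hs y hy).tendsto.comp (tendsto_nhdsWithin_iff.2 ⟨hlt y, ?_⟩)
    exact Eventually.of_forall fun n => Ioo_subset_Icc_self (hlm n y hy)
  set F : ℕ → ℝ → ℝ := fun n s => ∫ y in (0:ℝ)..π, u (l n y, s) * sin (k * y) with hF
  set F' : ℕ → ℝ → ℝ := fun n s => ∫ y in (0:ℝ)..π, us (l n y, s) * sin (k * y) with hF'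
  set F2 : ℕ → ℝ → ℝ := fun n s => ((k:ℝ)^2 / lam n ^ 2 - Q s) * F n s
    + k / lam n ^ 2 * (u (l n π, s) * cos (k * π) - u (l n 0, s)) with hF2
  have hcu : ContinuousOn u (Ioo 0 π ×ˢ Ioi 0) :=
    h.cont.mono (prod_mono Ioo_subset_Icc_self le_rfl)
  have d1 : ∀ n s, 0 < s → HasDerivAt (F n) (F' n s) s := fun n s hs =>
    param_deriv hcu h.cs h.ds (hlc n) (hlm n) (by fun_prop) s hs
  have hident : ∀ n s, 0 < s → ∫ y in (0:ℝ)..π, uss (l n y, s) * sin (k * y) = F2 n s := by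
    intro n s hs
    have hlam0 : lam n ≠ 0 := by have := hl2 n; linarith
    have hline : ∀ g : ℝ × ℝ → ℝ, ContinuousOn g (Ioo 0 π ×ˢ Ioi 0) →
        IntervalIntegrable (fun y => g (l n y, s) * sin (k * y)) MeasureTheory.volume 0 π := by
      intro g hg
      apply ContinuousOn.intervalIntegrable
      rw [hu]
      have := hlc n
      exact ContinuousOn.mul (hg.comp (by fun_prop) (fun y hy => ⟨hlm n y hy, hs⟩)) (by fun_prop)
    have i1 := hline uss h.css
    have i1n : IntervalIntegrable (fun y => -(uss (l n y, s) * sin (k * y)))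
        MeasureTheory.volume 0 π := i1.neg
    have i2 := hline u hcu
    have hint : ∫ y in (0:ℝ)..π, (-(uss (l n y, s) * sin (k * y))
        + ((k:ℝ)^2 / lam n ^ 2 - Q s) * (u (l n y, s) * sin (k * y))) =
        (ux (l n π, s) * sin (k * π) / lam n - k * (u (l n π, s) * cos (k * π)) / lam n ^ 2)
        - (ux (l n 0, s) * sin (k * 0) / lam n - k * (u (l n 0, s) * cos (k * 0)) / lam n ^ 2) := by
      apply intervalIntegral.integral_eq_sub_of_hasDerivAt
        (f := fun y => ux (l n y, s) * sin (k * y) / lam n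
          - k * (u (l n y, s) * cos (k * y)) / lam n ^ 2)
      · intro y hy
        rw [hu] at hy
        have hy' := hlm n y hy
        have hld : HasDerivAt (l n) (lam n) y := by
          refine ((((hasDerivAt_id y).sub_const (π/2)).const_mul (lam n)).const_add
            (π/2)).congr_deriv ?_
          simp
        have e1 : HasDerivAt (fun y => ux (l n y, s)) (uxx (l n y, s) * lam n) y :=
          (h.dxx _ hy' s hs).comp y hld
        have e2 : HasDerivAt (fun y => u (l n y, s)) (ux (l n y, s) * lam n) y :=
          (h.dx _ hy' s hs).comp y hld
        have e3 : HasDerivAt (fun y : ℝ => sin (k * y)) (cos (k * y) * k) y := by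
          simpa using ((hasDerivAt_id y).const_mul (k:ℝ)).sin
        have e4 : HasDerivAt (fun y : ℝ => cos (k * y)) (-sin (k * y) * k) y := by
          simpa using ((hasDerivAt_id y).const_mul (k:ℝ)).cos
        refine (((e1.mul e3).div_const (lam n)).sub
          (((e2.mul e4).const_mul (k:ℝ)).div_const (lam n ^ 2))).congr_deriv ?_
        have hp : uss (l n y, s) = -uxx (l n y, s) - Q s * u (l n y, s) := by
          linarith [h.pde _ hy' s hs]
        rw [hp]
        field_simp
        ring
      · exact i1n.add (i2.const_mul _)
    rw [intervalIntegral.integral_add i1n (i2.const_mul _), intervalIntegral.integral_neg,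
      intervalIntegral.integral_const_mul] at hint
    have hsin : sin (k * π) = 0 := sin_nat_mul_pi k
    simp only [hsin, mul_zero, sin_zero, cos_zero, zero_div, zero_sub, mul_one] at hint
    simp only [hF2, hF]
    linear_combination -hint
  have d2 : ∀ n s, 0 < s → HasDerivAt (F' n) (F2 n s) s := fun n s hs => by
    rw [← hident n s hs]
    exact param_deriv h.cs h.css h.dss (hlc n) (hlm n) (by fun_prop) s hs
  have hFb : ∀ n s, 0 < s → |F n s| ≤ B * π := by
    intro n s hs
    have := intervalIntegral.norm_integral_le_of_norm_le_const (a := 0) (b := π) (C := B)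
      (f := fun y => u (l n y, s) * sin (k * y)) (fun y hy => by
        have hy' := uIoc_subset_uIcc hy
        rw [hu] at hy'
        rw [norm_mul, norm_eq_abs, norm_eq_abs]
        have h1 := hB _ (Ioo_subset_Icc_self (hlm n y hy')) s hs
        have h2 := abs_sin_le_one (k * y)
        have h3 := abs_nonneg (u (l n y, s))
        have h4 := abs_nonneg (sin (k * y))
        nlinarith)
    rw [sub_zero, abs_of_pos hπ] at this
    exact this
  have h0m : (0:ℝ) ∈ Icc 0 π := ⟨le_rfl, hπ.le⟩
  have hπm : (π:ℝ) ∈ Icc 0 π := ⟨hπ.le, le_rfl⟩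
  have hFt : ∀ s, 0 < s → Tendsto (fun n => F n s) atTop (nhds (mode u k s)) := by
    intro s hs
    apply intervalIntegral.tendsto_integral_filter_of_dominated_convergence (fun _ => B)
    · refine Eventually.of_forall fun n => ?_
      apply ContinuousOn.aestronglyMeasurable _ measurableSet_uIoc
      refine ContinuousOn.mono ?_ uIoc_subset_uIcc
      rw [hu]
      have := hlc n
      exact ContinuousOn.mul (hcu.comp (by fun_prop) (fun y hy => ⟨hlm n y hy, hs⟩)) (by fun_prop)
    · refine Eventually.of_forall fun n => Eventually.of_forall fun y hy => ?_
      have hy' := uIoc_subset_uIcc hy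
      rw [hu] at hy'
      rw [norm_mul, norm_eq_abs, norm_eq_abs]
      have h1 := hB _ (Ioo_subset_Icc_self (hlm n y hy')) s hs
      have h2 := abs_sin_le_one (k * y)
      have h3 := abs_nonneg (u (l n y, s))
      have h4 := abs_nonneg (sin (k * y))
      nlinarith
    · exact intervalIntegrable_const
    · refine Eventually.of_forall fun y hy => ?_
      have hy' := uIoc_subset_uIcc hy
      rw [hu] at hy'
      exact (hut y hy' s hs).mul_const _
  refine limit_ode (F := F) (F' := F') (F2 := F2)
    (B := (4 * (k:ℝ)^2 + A) * (B * π) + 4 * k * (2 * B)) d1 d2 ?_ hFt ?_ ?_ ?_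
  · intro n
    have c1 : ContinuousOn (F n) (Ioi 0) := fun s hs => (d1 n s hs).continuousAt.continuousWithinAt
    have c2 : ∀ y ∈ Icc 0 π, ContinuousOn (fun s => u (l n y, s)) (Ioi 0) := fun y hy =>
      hcu.comp (by fun_prop) (fun s hs => ⟨hlm n y hy, hs⟩)
    have c3 := c2 0 h0m
    have c4 := c2 π hπm
    exact ((continuousOn_const.sub hQc.continuousOn).mul c1).add
      (continuousOn_const.mul ((c4.mul continuousOn_const).sub c3))
  · intro s hs
    have hl2t : Tendsto (fun n => lam n ^ 2) atTop (nhds 1) := by simpa using hltend.pow 2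
    have t1 : Tendsto (fun n => (k:ℝ)^2 / lam n ^ 2 - Q s) atTop (nhds ((k:ℝ)^2 - Q s)) := by
      have := (tendsto_const_nhds (x := (k:ℝ)^2)).div hl2t one_ne_zero
      simpa using this.sub_const (Q s)
    have t2 : Tendsto (fun n => (k:ℝ) / lam n ^ 2) atTop (nhds k) := by
      have := (tendsto_const_nhds (x := (k:ℝ))).div hl2t one_ne_zero
      rw [div_one] at this
      exact this
    have t3 := hut 0 h0m s hs
    have t4 := hut π hπm s hs
    rw [h.left s hs] at t3
    rw [h.right s hs] at t4
    have := (t1.mul (hFt s hs)).add (t2.mul ((t4.mul_const (cos (k * π))).sub t3))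
    simpa using this
  · intro n s hs
    have hinv : ∀ a : ℝ, 0 ≤ a → a / lam n ^ 2 ≤ 4 * a := by
      intro a ha
      have := hl2 n
      rw [div_le_iff₀ (by positivity)]
      have : 1/4 ≤ lam n ^ 2 := by nlinarith
      nlinarith
    have hinv0 : ∀ a : ℝ, 0 ≤ a → 0 ≤ a / lam n ^ 2 := fun a ha => by positivity
    have b1 := hinv ((k:ℝ)^2) (by positivity)
    have b1' := hinv0 ((k:ℝ)^2) (by positivity)
    have b2 := hinv k (by positivity)
    have b2' := hinv0 k (by positivity)
    have b3 : |(k:ℝ)^2 / lam n ^ 2 - Q s| ≤ 4 * (k:ℝ)^2 + A := by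
      have := hQ0 s; have := hQA s
      rw [abs_le]; constructor <;> nlinarith
    have b4 : |u (l n π, s) * cos (k * π) - u (l n 0, s)| ≤ 2 * B := by
      have h1 := hB _ (Ioo_subset_Icc_self (hlm n π hπm)) s hs
      have h2 := hB _ (Ioo_subset_Icc_self (hlm n 0 h0m)) s hs
      have h3 := abs_cos_le_one (k * π)
      have h4 : |u (l n π, s) * cos (k * π)| ≤ B := by
        rw [abs_mul]
        have h3 := abs_nonneg (u (l n π, s))
        have h4 := abs_nonneg (cos (k * π))
        nlinarith
      have := abs_sub (u (l n π, s) * cos (k * π)) (u (l n 0, s))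
      linarith
    calc |F2 n s| ≤ |((k:ℝ)^2 / lam n ^ 2 - Q s) * F n s|
        + |k / lam n ^ 2 * (u (l n π, s) * cos (k * π) - u (l n 0, s))| := abs_add_le _ _
      _ ≤ _ := by
        rw [abs_mul, abs_mul, abs_of_nonneg b2']
        have := hFb n s hs
        gcongr
  · exact (continuousOn_const.sub hQc.continuousOn).mul (h.mode_cont k)

lemma abs_sin_nat_mul_le (k : ℕ) (x : ℝ) : |sin (k * x)| ≤ k * |sin x| := by
  induction k with
  | zero => simp
  | succ k ih =>
    push_cast
    rw [add_mul, one_mul, sin_add]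
    have h1 := abs_add_le (sin (k * x) * cos x) (cos (k * x) * sin x)
    rw [abs_mul, abs_mul] at h1
    have h2 := abs_cos_le_one x
    have h3 := abs_cos_le_one (k * x)
    have h4 := abs_nonneg (sin (k * x))
    have h5 := abs_nonneg (sin x)
    nlinarith

lemma int_cast_natAbs_cases (n : ℤ) :
    (n : ℝ) = (n.natAbs : ℝ) ∨ (n : ℝ) = -(n.natAbs : ℝ) := by
  rcases Int.natAbs_eq n with h1 | h1
  · left
    have h2 := congrArg (Int.cast : ℤ → ℝ) h1
    rwa [Int.cast_natCast] at h2
  · right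
    have h2 := congrArg (Int.cast : ℤ → ℝ) h1
    rwa [Int.cast_neg, Int.cast_natCast] at h2

lemma abs_sin_int_mul_le (n : ℤ) (x : ℝ) : |sin (n * x)| ≤ (n.natAbs : ℝ) * |sin x| := by
  have h := abs_sin_nat_mul_le n.natAbs x
  rcases int_cast_natAbs_cases n with this | this
  · rw [this]; exact h
  · rw [this, neg_mul, sin_neg, abs_neg]; exact h

lemma exp_sub_exp (θ : ℝ) : Complex.exp (θ * Complex.I) - Complex.exp (-θ * Complex.I) =
    2 * Complex.I * (sin θ : ℝ) := by
  rw [Complex.ofReal_sin, Complex.sin]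
  ring_nf
  rw [Complex.I_sq]
  ring

lemma coeff_eq {w : ℝ → ℝ} (hw : Continuous w) (hneg : ∀ x ≤ 0, w x = 0) (n : ℤ) :
    ∫ x in (-π)..π, Complex.exp (-(n * x : ℝ) * Complex.I) * ((w x - w (-x) : ℝ) : ℂ) =
      -(2 * Complex.I) * ((∫ x in (0:ℝ)..π, w x * sin (n * x) : ℝ) : ℂ) := by
  have hπ := pi_pos
  have c1 : Continuous fun x : ℝ => Complex.exp (-(n * x : ℝ) * Complex.I) * (w x : ℂ) := by fun_prop
  have c2 : Continuous fun x : ℝ => Complex.exp (-(n * x : ℝ) * Complex.I) * (w (-x) : ℂ) := by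
    fun_prop
  have c3 : Continuous fun x : ℝ => Complex.exp ((n * x : ℝ) * Complex.I) * (w x : ℂ) := by fun_prop
  have e1 : ∫ x in (-π)..π, Complex.exp (-(n * x : ℝ) * Complex.I) * (w (-x) : ℂ) =
      ∫ x in (-π)..π, Complex.exp ((n * x : ℝ) * Complex.I) * (w x : ℂ) := by
    have := intervalIntegral.integral_comp_neg (a := -π) (b := π)
      (fun x : ℝ => Complex.exp ((n * x : ℝ) * Complex.I) * (w x : ℂ))
    rw [neg_neg] at this
    rw [← this]
    congr 1; ext x; push_cast; ring_nf
  have e2 : ∫ x in (-π)..π, Complex.exp (-(n * x : ℝ) * Complex.I) * ((w x - w (-x) : ℝ) : ℂ) =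
      ∫ x in (-π)..π, ((-(2 * Complex.I)) * ((w x * sin (n * x) : ℝ) : ℂ)) := by
    have : ∀ x : ℝ, Complex.exp (-(n * x : ℝ) * Complex.I) * ((w x - w (-x) : ℝ) : ℂ) =
      Complex.exp (-(n * x : ℝ) * Complex.I) * (w x : ℂ)
      - Complex.exp (-(n * x : ℝ) * Complex.I) * (w (-x) : ℂ) := by
        intro x; push_cast; ring
    simp_rw [this]
    rw [intervalIntegral.integral_sub (c1.intervalIntegrable _ _) (c2.intervalIntegrable _ _), e1,
      ← intervalIntegral.integral_sub (c1.intervalIntegrable _ _) (c3.intervalIntegrable _ _)]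
    congr 1; ext x
    have := exp_sub_exp (n * x)
    rw [Complex.ofReal_mul (w x)]
    linear_combination (-(w x : ℂ)) * this
  rw [e2, intervalIntegral.integral_const_mul, intervalIntegral.integral_ofReal]
  congr 2
  have c4 : Continuous fun x : ℝ => w x * sin (n * x) := by fun_prop
  rw [← intervalIntegral.integral_add_adjacent_intervals (c4.intervalIntegrable (-π) 0)
    (c4.intervalIntegrable 0 π)]
  have : ∫ x in (-π)..0, w x * sin (n * x) = 0 := by
    rw [intervalIntegral.integral_congr (g := fun _ => 0)]
    · simp
    · intro x hx
      rw [uIcc_of_le (by linarith)] at hx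
      simp [hneg x hx.2]
  rw [this, zero_add]

lemma sine_bound {b : ℕ → ℝ} (hb : Summable fun k : ℕ => (k:ℝ) * b k)
    (hb' : Summable b) (hb0 : ∀ k, 0 ≤ b k) :
    ∃ S : ℝ, 0 ≤ S ∧ ∀ w : ℝ → ℝ, ContinuousOn w (Icc 0 π) → w 0 = 0 → w π = 0 →
      ∀ N : ℝ, 0 ≤ N → (∀ k : ℕ, |∫ y in (0:ℝ)..π, w y * sin (k * y)| ≤ N * b k) →
      ∀ x ∈ Icc 0 π, |w x| ≤ N * S * sin x := by
  have hπ := pi_pos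
  have hZ : ∀ g : ℕ → ℝ, Summable g → Summable fun n : ℤ => g n.natAbs := by
    intro g hg
    apply Summable.of_nat_of_neg <;> simpa using hg
  have hZ1 := hZ _ hb
  refine ⟨(∑' n : ℤ, ((n.natAbs : ℕ):ℝ) * b n.natAbs) / π,
    div_nonneg (tsum_nonneg fun n => mul_nonneg (Nat.cast_nonneg _) (hb0 _)) hπ.le, ?_⟩
  intro w hw hw0 hwπ N hN hk x hx
  have hsx : 0 ≤ sin x := sin_nonneg_of_mem_Icc hx
  have hS : 0 ≤ (∑' n : ℤ, ((n.natAbs : ℕ):ℝ) * b n.natAbs) :=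
    tsum_nonneg fun n => mul_nonneg (Nat.cast_nonneg _) (hb0 _)
  rcases hx.2.eq_or_lt with hxπ | hxπ
  · rw [hxπ, hwπ, abs_zero, sin_pi, mul_zero]
  -- continuous extension
  set w' : ℝ → ℝ := IccExtend hπ.le ((Icc 0 π).domRestrict w) with hw'
  have hw'c : Continuous w' := hw.domRestrict.Icc_extend'
  have hw'eq : ∀ y ∈ Icc 0 π, w' y = w y := fun y hy => by
    rw [hw', IccExtend_of_mem _ _ hy]; rfl
  have hw'neg : ∀ y ≤ 0, w' y = 0 := fun y hy => by
    rw [hw', IccExtend_of_le_left _ _ hy]; exact hw0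
  have hw'pi : ∀ y, π ≤ y → w' y = 0 := fun y hy => by
    rw [hw', IccExtend_of_right_le _ _ hy]; exact hwπ
  set W : ℝ → ℂ := fun y => ((w' y - w' (-y) : ℝ) : ℂ) with hW
  have hWc : Continuous W := by fun_prop
  have : Fact (0 < 2 * π) := ⟨by linarith⟩
  have hends : W (-π) = W (-π + 2 * π) := by
    simp only [hW]
    rw [show -π + 2 * π = π by ring, neg_neg, hw'pi π le_rfl, hw'neg (-π) (by linarith)]
  set f : C(AddCircle (2 * π), ℂ) :=
    ⟨AddCircle.liftIco (2 * π) (-π) W, AddCircle.liftIco_continuous hends hWc.continuousOn⟩ with hf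
  have hfour : ∀ (n : ℤ) (y : ℝ), fourier n (y : AddCircle (2 * π)) =
      Complex.exp ((n * y : ℝ) * Complex.I) := by
    intro n y
    rw [fourier_coe_apply]
    congr 1
    have : (π : ℂ) ≠ 0 := by exact_mod_cast hπ.ne'
    push_cast
    field_simp
  have hcoef : ∀ n : ℤ, fourierCoeff f n = (1 / (2 * π) : ℝ) •
      (-(2 * Complex.I) * ((∫ x in (0:ℝ)..π, w' x * sin (n * x) : ℝ) : ℂ)) := by
    intro n
    rw [fourierCoeff_eq_intervalIntegral _ n (-π), ← coeff_eq hw'c hw'neg n]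
    congr 1
    rw [show -π + 2 * π = π by ring]
    refine intervalIntegral.integral_congr_Ioo_of_le (by linarith) fun y hy => ?_
    simp only [hf, ContinuousMap.coe_mk]
    rw [AddCircle.liftIco_coe_apply ⟨hy.1.le, by linarith [hy.2]⟩, hfour, smul_eq_mul]
    simp only [hW]
    push_cast
    ring_nf
  have hcn : ∀ n : ℤ, ‖fourierCoeff f n‖ ≤ N * b n.natAbs / π := by
    intro n
    have hI : |∫ x in (0:ℝ)..π, w' x * sin (n * x)| ≤ N * b n.natAbs := by
      have e : ∫ x in (0:ℝ)..π, w' x * sin (n * x) = ∫ x in (0:ℝ)..π, w x * sin (n * x) := by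
        apply intervalIntegral.integral_congr
        intro y hy
        rw [uIcc_of_le hπ.le] at hy
        simp only [hw'eq y hy]
      rw [e]
      have h := hk n.natAbs
      rcases int_cast_natAbs_cases n with this | this
      · rw [this]; exact h
      · rw [this]
        simp only [neg_mul, sin_neg, mul_neg, intervalIntegral.integral_neg, abs_neg]
        exact h
    rw [hcoef, norm_smul, norm_mul, norm_neg, norm_mul, Complex.norm_I, Complex.norm_real,
      norm_eq_abs, norm_eq_abs, abs_of_pos (by positivity)]
    have : ‖(2:ℂ)‖ = 2 := by simp
    rw [this, le_div_iff₀ hπ]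
    calc _ = |∫ x in (0:ℝ)..π, w' x * sin (n * x)| := by field_simp
      _ ≤ _ := hI
  have hsum : Summable (fourierCoeff f) := by
    refine Summable.of_norm_bounded (g := fun n : ℤ => N * b n.natAbs / π) ?_ hcn
    exact ((hZ b hb').mul_left N).div_const π
  have hs1 := has_pointwise_sum_fourier_series_of_summable hsum (x : AddCircle (2 * π))
  have hs2 := has_pointwise_sum_fourier_series_of_summable hsum ((-x : ℝ) : AddCircle (2 * π))
  have hfx : f (x : AddCircle (2 * π)) = (w x : ℂ) := by
    simp only [hf, ContinuousMap.coe_mk]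
    rw [AddCircle.liftIco_coe_apply ⟨by linarith [hx.1], by linarith⟩]
    simp only [hW]
    rw [hw'eq x hx, hw'neg (-x) (by linarith [hx.1]), sub_zero]
  have hfx' : f ((-x : ℝ) : AddCircle (2 * π)) = -(w x : ℂ) := by
    simp only [hf, ContinuousMap.coe_mk]
    rw [AddCircle.liftIco_coe_apply ⟨by linarith [hx.1], by linarith [hx.1]⟩]
    simp only [hW]
    rw [neg_neg, hw'eq x hx, hw'neg (-x) (by linarith [hx.1]), zero_sub]
    push_cast; rfl
  rw [hfx] at hs1
  rw [hfx'] at hs2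
  have hs3 := hs1.sub hs2
  have hbound : ∀ n : ℤ, ‖fourierCoeff f n • fourier n (x : AddCircle (2 * π)) -
      fourierCoeff f n • fourier n ((-x : ℝ) : AddCircle (2 * π))‖ ≤
      (2 * N / π * sin x) * (((n.natAbs : ℕ):ℝ) * b n.natAbs) := by
    intro n
    rw [← smul_sub, hfour, hfour]
    have e := exp_sub_exp (n * x)
    have e' : ((n * -x : ℝ) : ℂ) = -((n * x : ℝ) : ℂ) := by push_cast; ring
    rw [e', e, norm_smul, norm_mul, norm_mul, Complex.norm_I, Complex.norm_real, norm_eq_abs]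
    have h2 : ‖(2:ℂ)‖ = 2 := by simp
    rw [h2]
    have h3 := hcn n
    have h4 := abs_sin_int_mul_le n x
    rw [abs_of_nonneg hsx] at h4
    calc ‖fourierCoeff f n‖ * (2 * 1 * |sin (n * x)|)
        ≤ (N * b n.natAbs / π) * (2 * 1 * (n.natAbs * sin x)) := by
          have := hb0 n.natAbs
          gcongr
      _ = _ := by ring
  have hfin := tsum_of_norm_bounded (hZ1.hasSum.mul_left (2 * N / π * sin x)) hbound
  rw [hs3.tsum_eq, sub_neg_eq_add, ← two_mul, norm_mul, Complex.norm_real, norm_eq_abs] at hfin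
  have h2 : ‖(2:ℂ)‖ = 2 := by simp
  rw [h2] at hfin
  calc |w x| ≤ (2 * N / π * sin x * ∑' n : ℤ, ((n.natAbs : ℕ):ℝ) * b n.natAbs) / 2 := by linarith
    _ = _ := by ring

lemma second_deriv_min {g g' : ℝ → ℝ} {g2 x a b : ℝ} (hx : x ∈ Ioo a b)
    (h1 : ∀ y ∈ Ioo a b, HasDerivAt g (g' y) y) (h2 : HasDerivAt g' g2 x)
    (hmin : ∀ y ∈ Ioo a b, g x ≤ g y) : 0 ≤ g2 := by
  by_contra hneg
  push Not at hneg
  have hn : Ioo a b ∈ nhds x := Ioo_mem_nhds hx.1 hx.2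
  have e : deriv g =ᶠ[nhds x] g' := by
    filter_upwards [hn] with y hy
    exact (h1 y hy).deriv
  have hdd : deriv (deriv g) x = g2 := by rw [e.deriv_eq, h2.deriv]
  have hlm : IsLocalMin g x := by
    filter_upwards [hn] with y hy
    exact hmin y hy
  have hmax : IsLocalMax g x := isLocalMax_of_deriv_deriv_neg (by rw [hdd]; exact hneg)
    hlm.deriv_eq_zero (h1 x hx).continuousAt
  have hconst : g =ᶠ[nhds x] fun _ => g x := by
    filter_upwards [hlm, hmax] with y hy1 hy2
    exact le_antisymm hy2 hy1
  have hd0 : deriv g =ᶠ[nhds x] fun _ => 0 := by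
    have := hconst.deriv
    simpa using this
  have h0 : deriv (deriv g) x = 0 := by rw [hd0.deriv_eq]; simp
  rw [hdd] at h0
  linarith

lemma Good.nonneg (h : Good Q u us uss ux uxx) {x s : ℝ} (hx : x ∈ Icc 0 π) (hs : 0 < s) :
    0 ≤ u (x, s) := by
  rcases hx.1.eq_or_lt with h0 | h0
  · rw [← h0, h.left s hs]
  rcases hx.2.eq_or_lt with h1 | h1
  · rw [h1, h.right s hs]
  exact (h.pos x ⟨h0, h1⟩ s hs).le

/-- Comparison with the harmonic function `sin x · sinh (s - 1/2)`. -/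
lemma Good.max_principle (h : Good Q u us uss ux uxx) (hQ0 : ∀ s, 0 ≤ Q s) {T b : ℝ}
    (hT : 1/2 < T)
    (htop : ∀ x ∈ Icc 0 π, b * (sin x * sinh (T - 1/2)) ≤ u (x, T)) :
    ∀ x ∈ Icc 0 π, ∀ s ∈ Icc (1/2) T, b * (sin x * sinh (s - 1/2)) ≤ u (x, s) := by
  have hπ := pi_pos
  intro x hx s hs
  suffices H : ∀ ε > 0, b * (sin x * sinh (s - 1/2)) ≤ u (x, s) + ε * π^2 by
    refine le_of_forall_pos_le_add fun δ hδ => ?_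
    have := H (δ / π^2) (by positivity)
    rwa [div_mul_cancel₀ _ (by positivity)] at this
  intro ε hε
  set Z : ℝ × ℝ → ℝ := fun p => u p - b * (sin p.1 * sinh (p.2 - 1/2)) + ε * (π^2 - p.1^2) with hZ
  set K : Set (ℝ × ℝ) := Icc 0 π ×ˢ Icc (1/2) T with hK
  have hKc : IsCompact K := isCompact_Icc.prod isCompact_Icc
  have hZc : ContinuousOn Z K := by
    have h1 : ContinuousOn u K := h.cont.mono (prod_mono le_rfl fun r hr =>
      lt_of_lt_of_le (by norm_num : (0:ℝ) < 1/2) hr.1)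
    have h2 : Continuous fun p : ℝ × ℝ => b * (sin p.1 * sinh (p.2 - 1/2)) :=
      continuous_const.mul ((continuous_sin.comp continuous_fst).mul
        (continuous_sinh.comp (continuous_snd.sub continuous_const)))
    have h3 : Continuous fun p : ℝ × ℝ => ε * (π^2 - p.1^2) := by fun_prop
    exact (h1.sub h2.continuousOn).add h3.continuousOn
  obtain ⟨⟨x₀, s₀⟩, ⟨hx₀, hs₀⟩, hmin⟩ := hKc.exists_isMinOn ⟨(x, s), hx, hs⟩ hZc
  have hmin' : ∀ p ∈ K, Z (x₀, s₀) ≤ Z p := hmin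
  simp only at hx₀ hs₀
  have hs₀0 : 0 < s₀ := lt_of_lt_of_le (by norm_num : (0:ℝ) < 1/2) hs₀.1
  have hextra : 0 ≤ ε * (π^2 - x₀^2) := by
    have h1 := hx₀.1; have h2 := hx₀.2
    apply mul_nonneg hε.le; nlinarith
  have hZ0 : 0 ≤ Z (x₀, s₀) := by
    rcases hx₀.1.eq_or_lt with e1 | e1
    · simp only [hZ]
      rw [← e1] at hextra ⊢
      rw [h.left s₀ hs₀0, sin_zero]; linarith
    rcases hx₀.2.eq_or_lt with e2 | e2
    · simp only [hZ]
      rw [e2] at hextra ⊢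
      rw [h.right s₀ hs₀0, sin_pi]; linarith
    rcases hs₀.1.eq_or_lt with e3 | e3
    · simp only [hZ]
      have := h.nonneg hx₀ hs₀0
      rw [← e3] at this ⊢
      rw [sub_self, sinh_zero]; linarith
    rcases hs₀.2.eq_or_lt with e4 | e4
    · simp only [hZ]
      have := htop x₀ hx₀
      rw [e4]
      linarith
    exfalso
    have hxi : x₀ ∈ Ioo 0 π := ⟨e1, e2⟩
    have A1 : 0 ≤ uxx (x₀, s₀) + b * (sin x₀ * sinh (s₀ - 1/2)) - ε * 2 := by
      refine second_deriv_min (g := fun y => Z (y, s₀))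
        (g' := fun y => ux (y, s₀) - b * (cos y * sinh (s₀ - 1/2)) - ε * (2 * y)) hxi ?_ ?_ ?_
      · intro y hy
        refine (((h.dx y hy s₀ hs₀0).sub (((hasDerivAt_sin y).mul_const (sinh (s₀ - 1/2))).const_mul b)).add
          (((show HasDerivAt (fun y : ℝ => y ^ 2) (2 * y) y by
            simpa using hasDerivAt_pow 2 y).const_sub (π^2)).const_mul ε)).congr_deriv ?_
        simp
        ring
      · refine (((h.dxx x₀ hxi s₀ hs₀0).sub (((hasDerivAt_cos x₀).mul_const _).const_mul b)).sub
          (((hasDerivAt_id x₀).const_mul 2).const_mul ε)).congr_deriv ?_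
        ring
      · intro y hy
        exact hmin' (y, s₀) ⟨Ioo_subset_Icc_self hy, hs₀⟩
    have A2 : 0 ≤ uss (x₀, s₀) - b * (sin x₀ * sinh (s₀ - 1/2)) := by
      refine second_deriv_min (g := fun r => Z (x₀, r)) (a := 1/2) (b := T)
        (g' := fun r => us (x₀, r) - b * (sin x₀ * cosh (r - 1/2))) ⟨e3, e4⟩ ?_ ?_ ?_
      · intro r hr
        have hr0 : 0 < r := lt_trans (by norm_num : (0:ℝ) < 1/2) hr.1
        have := (((hasDerivAt_id r).sub_const (1/2)).sinh)
        refine (((h.ds x₀ hxi r hr0).sub ((this.const_mul (sin x₀)).const_mul b)).add_const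
          (ε * (π^2 - x₀^2))).congr_deriv ?_
        simp
      · have := (((hasDerivAt_id s₀).sub_const (1/2)).cosh)
        refine ((h.dss x₀ hxi s₀ hs₀0).sub ((this.const_mul (sin x₀)).const_mul b)).congr_deriv ?_
        simp
      · intro r hr
        exact hmin' (x₀, r) ⟨hx₀, Ioo_subset_Icc_self hr⟩
    have A3 := h.pde x₀ hxi s₀ hs₀0
    have A4 := mul_nonneg (hQ0 s₀) (h.pos x₀ hxi s₀ hs₀0).le
    linarith
  have hZx := hZ0.trans (hmin' (x, s) ⟨hx, hs⟩)
  simp only [hZ] at hZx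
  have : ε * (π^2 - x^2) ≤ ε * π^2 := by
    have := sq_nonneg x
    gcongr; linarith
  linarith

lemma Good.intble (h : Good Q u us uss ux uxx) {s : ℝ} (hs : 0 < s) (k : ℕ) :
    IntervalIntegrable (fun y => u (y, s) * sin (k * y)) MeasureTheory.volume 0 π := by
  apply ContinuousOn.intervalIntegrable
  rw [uIcc_of_le pi_pos.le]
  exact (h.contx hs).mul (by fun_prop)

lemma Good.mode_pos (h : Good Q u us uss ux uxx) {s : ℝ} (hs : 0 < s) : 0 < mode u 1 s := by
  apply intervalIntegral.intervalIntegral_pos_of_pos_on (h.intble hs 1) _ pi_pos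
  intro x hx
  have h1 := h.pos x hx s hs
  have h2 := sin_pos_of_mem_Ioo hx
  simp only [Nat.cast_one, one_mul]
  positivity

lemma Good.mode_le (h : Good Q u us uss ux uxx) {s : ℝ} (hs : 0 < s) (k : ℕ) :
    |mode u k s| ≤ k * mode u 1 s := by
  unfold mode
  rw [← intervalIntegral.integral_const_mul]
  refine (intervalIntegral.abs_integral_le_integral_abs pi_pos.le).trans ?_
  apply intervalIntegral.integral_mono_on pi_pos.le (h.intble hs k).abs
    ((h.intble hs 1).const_mul _)
  intro x hx
  have h1 := h.nonneg hx hs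
  have h2 := abs_sin_nat_mul_le k x
  rw [abs_of_nonneg (sin_nonneg_of_mem_Icc hx)] at h2
  rw [abs_mul, abs_of_nonneg h1, Nat.cast_one, one_mul]
  nlinarith

lemma Good.mode_bdd (h : Good Q u us uss ux uxx) : ∃ B, ∀ s, 0 < s → mode u 1 s ≤ B := by
  obtain ⟨B, hB⟩ := h.bdd
  refine ⟨B * π, fun s hs => ?_⟩
  have := intervalIntegral.norm_integral_le_of_norm_le_const (a := 0) (b := π) (C := B)
    (f := fun y => u (y, s) * sin ((1:ℕ) * y)) (fun y hy => by
      have hy' := uIoc_subset_uIcc hy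
      rw [uIcc_of_le pi_pos.le] at hy'
      rw [norm_mul, norm_eq_abs, norm_eq_abs]
      have h1 := hB y hy' s hs
      have h2 := abs_sin_le_one ((1:ℕ) * y)
      have h3 := abs_nonneg (u (y, s))
      have h4 := abs_nonneg (sin ((1:ℕ) * y))
      nlinarith)
  rw [sub_zero, abs_of_pos pi_pos] at this
  exact (le_abs_self _).trans this

lemma integral_sin_one : ∫ y in (0:ℝ)..π, sin y * sin ((1:ℕ) * y) = π / 2 := by
  simp only [Nat.cast_one, one_mul, ← sq]
  rw [integral_sin_sq]
  simp

lemma integral_sin_ne (k : ℕ) (hk : k ≠ 1) : ∫ y in (0:ℝ)..π, sin y * sin (k * y) = 0 := by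
  have hk1 : (k:ℝ) - 1 ≠ 0 := by
    intro h; apply hk; exact_mod_cast sub_eq_zero.1 h
  have hk2 : (k:ℝ) + 1 ≠ 0 := by positivity
  have : ∫ y in (0:ℝ)..π, sin y * sin (k * y) =
      (sin ((k - 1) * π) / (2 * (k - 1)) - sin ((k + 1) * π) / (2 * (k + 1)))
      - (sin (((k:ℝ) - 1) * 0) / (2 * (k - 1)) - sin (((k:ℝ) + 1) * 0) / (2 * (k + 1))) := by
    apply intervalIntegral.integral_eq_sub_of_hasDerivAt
      (f := fun y => sin (((k:ℝ) - 1) * y) / (2 * (k - 1)) - sin (((k:ℝ) + 1) * y) / (2 * (k + 1)))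
    · intro y _
      have e1 := (((hasDerivAt_id y).const_mul ((k:ℝ) - 1)).sin).div_const (2 * ((k:ℝ) - 1))
      have e2 := (((hasDerivAt_id y).const_mul ((k:ℝ) + 1)).sin).div_const (2 * ((k:ℝ) + 1))
      refine (e1.sub e2).congr_deriv ?_
      simp only [id, mul_one]
      have c1 : cos (((k:ℝ) - 1) * y) = cos (k * y) * cos y + sin (k * y) * sin y := by
        rw [sub_mul, one_mul, cos_sub]
      have c2 : cos (((k:ℝ) + 1) * y) = cos (k * y) * cos y - sin (k * y) * sin y := by
        rw [add_mul, one_mul, cos_add]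
      rw [c1, c2]
      field_simp
      ring
    · exact (by fun_prop : Continuous fun y : ℝ => sin y * sin (k * y)).intervalIntegrable _ _
  rw [this]
  have s1 : sin (((k:ℝ) - 1) * π) = 0 := by rw [sub_mul, one_mul, sin_sub_pi, sin_nat_mul_pi, neg_zero]
  have s2 : sin (((k:ℝ) + 1) * π) = 0 := by rw [add_mul, one_mul, sin_add_pi, sin_nat_mul_pi, neg_zero]
  simp [s1, s2]

/-- The weights of the sine series. -/
noncomputable def bw (k : ℕ) : ℝ := if k = 1 then 0 else k * exp (-k)

lemma bw_nonneg (k : ℕ) : 0 ≤ bw k := by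
  unfold bw; split_ifs
  · exact le_rfl
  · positivity

lemma bw_le (k : ℕ) : bw k ≤ k * exp (-k) := by
  unfold bw; split_ifs
  · positivity
  · exact le_rfl

lemma bw_summable : Summable bw := by
  refine Summable.of_nonneg_of_le bw_nonneg bw_le ?_
  simpa using Real.summable_pow_mul_exp_neg_nat_mul 1 one_pos

lemma bw_summable' : Summable fun k : ℕ => (k:ℝ) * bw k := by
  refine Summable.of_nonneg_of_le (fun k => mul_nonneg k.cast_nonneg (bw_nonneg k))
    (fun k => mul_le_mul_of_nonneg_left (bw_le k) k.cast_nonneg) ?_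
  refine (Real.summable_pow_mul_exp_neg_nat_mul 2 one_pos).congr fun k => ?_
  rw [show -1 * (k:ℝ) = -k by ring]; ring

/-- From decay of modes to the weights. -/
lemma mode_weight {M F s a : ℝ} (hM : 0 ≤ M) (hF : 0 ≤ F) (hs : 1 ≤ s) {k : ℕ}
    (h1 : k = 1 → a = 0) (h0 : k = 0 → a = 0)
    (h : 1 ≤ k → |a| ≤ M * k * exp (-((k:ℝ) - 1) * s) * F) :
    |a| ≤ (M * F * exp (2 - s)) * bw k := by
  rcases Nat.lt_or_ge k 2 with hk | hk
  · have : a = 0 := by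
      interval_cases k
      · exact h0 rfl
      · exact h1 rfl
    rw [this, abs_zero]
    have := bw_nonneg k
    positivity
  · refine (h (by omega)).trans ?_
    have hb : bw k = k * exp (-k) := by unfold bw; rw [if_neg (by omega)]
    have hk' : (2:ℝ) ≤ k := by exact_mod_cast hk
    have he : exp (-((k:ℝ) - 1) * s) ≤ exp (2 - s) * exp (-k) := by
      rw [← exp_add]
      apply exp_le_exp.2
      nlinarith
    rw [hb]
    calc M * k * exp (-((k:ℝ) - 1) * s) * F ≤ M * k * (exp (2 - s) * exp (-k)) * F := by gcongr
      _ = _ := by ring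

theorem abstract_main : ∃ C : ℝ, 1 ≤ C ∧ ∀ (Q : ℝ → ℝ) (A : ℝ), Continuous Q → (∀ s, 0 ≤ Q s) →
    (∀ s, Q s ≤ A) → ∀ u us uss ux uxx V Vs Vss Vx Vxx : ℝ × ℝ → ℝ,
    Good Q u us uss ux uxx → Good Q V Vs Vss Vx Vxx →
    Tendsto (mode u 1) atTop (nhds 0) → ∀ s₁, 0 < s₁ → mode u 1 s₁ = mode V 1 s₁ →
    ∀ x ∈ Ioo 0 π, ∀ s, 1 ≤ s → |u (x, s) / V (x, s) - 1| ≤ C * exp (-s) := by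
  have hπ := pi_pos
  obtain ⟨S, hS0, hS⟩ := sine_bound bw_summable' bw_summable bw_nonneg
  set T := 2 + log (π * (S + 1)) with hT
  have hπS : 1 ≤ π * (S + 1) := by nlinarith [pi_gt_three]
  have hT2 : 2 ≤ T := by have := log_nonneg hπS; linarith
  have hTe : exp (2 - T) = 1 / (π * (S + 1)) := by
    rw [hT, show 2 - (2 + log (π * (S + 1))) = -log (π * (S + 1)) by ring, exp_neg,
      exp_log (by linarith), one_div]
  have hsh1 : 0 < sinh (1/2) := sinh_pos_iff.2 (by norm_num)
  have hsh2 : 0 < sinh (T - 1/2) := sinh_pos_iff.2 (by linarith)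
  set c₀ := 1 / π * exp (-T) * (sinh (1/2) / sinh (T - 1/2)) with hc₀
  have hc₀pos : 0 < c₀ := by positivity
  have hc₀le : c₀ ≤ 1 / π := by
    have h1 : exp (-T) ≤ 1 := by rw [exp_le_one_iff]; linarith
    have h2 : sinh (1/2) / sinh (T - 1/2) ≤ 1 := by
      rw [div_le_one hsh2]; exact sinh_le_sinh.2 (by linarith)
    have h3 : 0 < sinh (1/2) / sinh (T - 1/2) := by positivity
    rw [hc₀]
    calc _ ≤ 1 / π * 1 * 1 := by gcongr
      _ = _ := by ring
  refine ⟨1 + 2 * exp 2 * S / c₀, by have : 0 ≤ 2 * exp 2 * S / c₀ := by positivity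
                                     linarith, ?_⟩
  intro Q A hQc hQ0 hQA u us uss ux uxx V Vs Vss Vx Vxx hu hV hlim s₁ hs₁ heq x hx s hs
  choose du hdu using hu.mode_ode hQc hQ0 hQA
  choose dV hdV using hV.mode_ode hQc hQ0 hQA
  have hs0 : 0 < s := by linarith
  set f := mode u 1 with hf
  have f1 : ∀ s, 0 < s → HasDerivAt f (du 1 s) s := fun s hs => (hdu 1 s hs).1
  have f2 : ∀ s, 0 < s → HasDerivAt (du 1) ((1 - Q s) * f s) s := fun s hs => by
    simpa using (hdu 1 s hs).2
  have g1 : ∀ s, 0 < s → HasDerivAt (mode V 1) (dV 1 s) s := fun s hs => (hdV 1 s hs).1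
  have g2 : ∀ s, 0 < s → HasDerivAt (dV 1) ((1 - Q s) * mode V 1 s) s := fun s hs => by
    simpa using (hdV 1 s hs).2
  have fpos : ∀ s, 0 < s → 0 < f s := fun s hs => hu.mode_pos hs
  have gpos : ∀ s, 0 < s → 0 < mode V 1 s := fun s hs => hV.mode_pos hs
  obtain ⟨B1, hB1⟩ := hu.mode_bdd
  obtain ⟨B2, hB2⟩ := hV.mode_bdd
  have hfg : ∀ s, 0 < s → f s = mode V 1 s := wronski (B := max B1 B2) fpos gpos
    (fun s hs => (hB1 s hs).trans (le_max_left _ _))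
    (fun s hs => (hB2 s hs).trans (le_max_right _ _)) f1 f2 g1 g2 s₁ hs₁ heq
  -- difference estimate
  have hdiff : ∀ x ∈ Icc 0 π, |u (x, s) - V (x, s)| ≤ 2 * f s * exp (2 - s) * S * sin x := by
    intro x hx
    have hfs := fpos s hs0
    refine hS (fun x => u (x, s) - V (x, s)) ((hu.contx hs0).sub (hV.contx hs0))
      (by simp only [hu.left s hs0, hV.left s hs0, sub_zero])
      (by simp only [hu.right s hs0, hV.right s hs0, sub_zero])
      (2 * f s * exp (2 - s)) (by positivity) ?_ x hx
    intro k
    have e : ∫ y in (0:ℝ)..π, (u (y, s) - V (y, s)) * sin (k * y) = mode u k s - mode V k s := by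
      unfold mode
      rw [← intervalIntegral.integral_sub (hu.intble hs0 k) (hV.intble hs0 k)]
      congr 1; ext y; ring
    rw [e]
    refine mode_weight two_pos.le hfs.le hs ?_ ?_ ?_
    · rintro rfl
      rw [← hfg s hs0, ← hf, sub_self]
    · rintro rfl
      simp [mode]
    · intro hk
      have hk' : (1:ℝ) ≤ k := by exact_mod_cast hk
      refine decay (κ := k) (M := 2 * k) (w := fun s => mode u k s - mode V k s)
        (w' := fun s => du k s - dV k s) hk' hQ0 fpos hlim f1 f2 ?_ ?_ ?_ s hs0
      · exact fun r hr => (hdu k r hr).1.sub (hdV k r hr).1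
      · intro r hr
        refine ((hdu k r hr).2.sub (hdV k r hr).2).congr_deriv ?_
        ring
      · intro r hr
        have h1 := hu.mode_le hr k
        have h2 := hV.mode_le hr k
        rw [← hfg r hr] at h2
        have := abs_sub (mode u k r) (mode V k r)
        linarith
  -- lower bound far away
  have hlow1 : ∀ r, T ≤ r → ∀ x ∈ Icc 0 π, 1 / π * f r * sin x ≤ V (x, r) := by
    intro r hr x hx
    have hr0 : 0 < r := by linarith
    have hr1 : 1 ≤ r := by linarith
    have hfr := fpos r hr0
    have hb : |V (x, r) - 2 / π * f r * sin x| ≤ 1 * f r * exp (2 - r) * S * sin x := by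
      refine hS (fun x => V (x, r) - 2 / π * f r * sin x)
        ((hV.contx hr0).sub (by fun_prop))
        (by simp only [hV.left r hr0, sin_zero, mul_zero, sub_zero])
        (by simp only [hV.right r hr0, sin_pi, mul_zero, sub_zero])
        (1 * f r * exp (2 - r)) (by positivity) ?_ x hx
      intro k
      have e : ∫ y in (0:ℝ)..π, (V (y, r) - 2 / π * f r * sin y) * sin (k * y) =
          mode V k r - 2 / π * f r * ∫ y in (0:ℝ)..π, sin y * sin (k * y) := by
        unfold mode
        rw [← intervalIntegral.integral_const_mul, ← intervalIntegral.integral_sub (hV.intble hr0 k)]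
        · congr 1; ext y; ring
        · exact (by fun_prop : Continuous fun y : ℝ =>
            2 / π * f r * (sin y * sin (k * y))).intervalIntegrable _ _
      rw [e]
      refine mode_weight one_pos.le hfr.le hr1 ?_ ?_ ?_
      · rintro rfl
        rw [integral_sin_one, ← hfg r hr0]
        field_simp
        ring
      · rintro rfl
        simp [mode]
      · intro hk
        by_cases hk1 : k = 1
        · subst hk1
          rw [integral_sin_one, ← hfg r hr0, show f r - 2 / π * f r * (π / 2) = 0 by
            field_simp; ring, abs_zero]
          positivity
        have hk' : (1:ℝ) ≤ k := by exact_mod_cast hk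
        rw [integral_sin_ne k hk1, mul_zero, sub_zero, one_mul]
        refine decay (κ := k) (M := k) (w := mode V k)
          (w' := dV k) hk' hQ0 fpos hlim f1 f2 (fun r hr => (hdV k r hr).1)
          (fun r hr => (hdV k r hr).2) ?_ r hr0
        intro q hq
        rw [hfg q hq]
        exact hV.mode_le hq k
    have hsx : 0 ≤ sin x := sin_nonneg_of_mem_Icc hx
    have he : exp (2 - r) * S ≤ 1 / π := by
      have h1 : exp (2 - r) ≤ exp (2 - T) := exp_le_exp.2 (by linarith)
      rw [hTe] at h1
      calc exp (2 - r) * S ≤ 1 / (π * (S + 1)) * S := by gcongr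
        _ ≤ 1 / π := by
          rw [div_mul_eq_mul_div, div_le_div_iff₀ (by positivity) hπ]
          nlinarith
    have h3 : 1 * f r * exp (2 - r) * S * sin x ≤ 1 / π * f r * sin x := by
      calc 1 * f r * exp (2 - r) * S * sin x = (exp (2 - r) * S) * (f r * sin x) := by ring
        _ ≤ 1 / π * (f r * sin x) := by gcongr
        _ = _ := by ring
    have h4 := (abs_le.1 hb).1
    have h5 : 2 / π * f r * sin x = 1 / π * f r * sin x + 1 / π * f r * sin x := by ring
    linarith
  -- lower bound everywhere
  have hxI := Ioo_subset_Icc_self hx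
  have hsx : 0 < sin x := sin_pos_of_mem_Ioo hx
  have hfs := fpos s hs0
  have hlow : c₀ * f s * sin x ≤ V (x, s) := by
    rcases le_total T s with hTs | hTs
    · refine le_trans ?_ (hlow1 s hTs x hxI)
      gcongr
    · have hfT := fpos T (by linarith)
      have hmp := hV.max_principle hQ0 (T := T) (b := 1 / π * f T / sinh (T - 1/2)) (by linarith)
        (fun y hy => by
          refine le_trans (le_of_eq ?_) (hlow1 T le_rfl y hy)
          rw [← mul_assoc, mul_right_comm, div_mul_cancel₀ _ hsh2.ne']) x hxI s ⟨by linarith, hTs⟩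
      refine le_trans ?_ hmp
      have hgr : f s * exp s ≤ f T * exp T := by
        have hd : ∀ t, 0 < t → HasDerivAt (fun t => f t * exp t) ((du 1 t + f t) * exp t) t := by
          intro t ht
          refine ((f1 t ht).mul (hasDerivAt_exp t)).congr_deriv ?_
          ring
        have := growth hd (c := 0) hs0 hTs (fun r hr _ =>
          mul_nonneg (riccati hQ0 fpos f1 f2 r (by linarith)) (exp_pos r).le)
        simpa using this
      have hf' : exp (-T) * f s ≤ f T := by
        have h1 : f s ≤ f s * exp s := by
          have := one_le_exp hs0.le
          nlinarith
        rw [exp_neg, inv_mul_le_iff₀ (exp_pos T)]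
        linarith
      have hsh3 : sinh (1/2) ≤ sinh (s - 1/2) := sinh_le_sinh.2 (by linarith)
      calc c₀ * f s * sin x = 1 / π * (exp (-T) * f s) / sinh (T - 1/2) * (sin x * sinh (1/2)) := by
            rw [hc₀]; ring
        _ ≤ _ := by gcongr
  have hVpos := hV.pos x hx s hs0
  rw [div_sub_one hVpos.ne', abs_div, abs_of_pos hVpos, div_le_iff₀ hVpos]
  have hc0' : 0 ≤ 2 * exp 2 * S / c₀ := by positivity
  calc |u (x, s) - V (x, s)| ≤ 2 * f s * exp (2 - s) * S * sin x := hdiff x hxI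
    _ = 2 * exp 2 * S / c₀ * exp (-s) * (c₀ * f s * sin x) := by
      rw [show 2 - s = 2 + -s by ring, exp_add]; field_simp
    _ ≤ (1 + 2 * exp 2 * S / c₀) * exp (-s) * V (x, s) := by
      gcongr
      linarith


theorem hasDerivAt_snd {h : ℝ × ℝ → ℝ} {a s d : ℝ} {g : ℝ → ℝ}
    (hh : DifferentiableAt ℝ h (a, g s)) (hg : HasDerivAt g d s) :
    HasDerivAt (fun s => h (a, g s)) (pdy h (a, g s) * d) s := by
  have h1 : HasDerivAt (fun s => (a, g s)) ((0:ℝ), d) s := (hasDerivAt_const s a).prodMk hg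
  refine (hh.hasFDerivAt.comp_hasDerivAt s h1).congr_deriv ?_
  have e : ((0:ℝ), d) = d • ((0:ℝ), (1:ℝ)) := by simp
  rw [e, map_smul, pdy, smul_eq_mul, mul_comm]

theorem hasDerivAt_fst {h : ℝ × ℝ → ℝ} {b s d : ℝ} {g : ℝ → ℝ}
    (hh : DifferentiableAt ℝ h (g s, b)) (hg : HasDerivAt g d s) :
    HasDerivAt (fun s => h (g s, b)) (pdx h (g s, b) * d) s := by
  have h1 : HasDerivAt (fun s => (g s, b)) (d, (0:ℝ)) s := hg.prodMk (hasDerivAt_const s b)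
  refine (hh.hasFDerivAt.comp_hasDerivAt s h1).congr_deriv ?_
  have e : (d, (0:ℝ)) = d • ((1:ℝ), (0:ℝ)) := by simp
  rw [e, map_smul, pdx, smul_eq_mul, mul_comm]

/-- Mercator-type change of variables. -/
noncomputable def gg (m s : ℝ) : ℝ := arctan (sinh (s / m))

theorem gg_cont (m : ℝ) : Continuous (gg m) := by
  unfold gg; fun_prop

theorem gg_pos {m s : ℝ} (hm : 0 < m) (hs : 0 < s) : 0 < gg m s := by
  unfold gg
  rw [arctan_pos, sinh_pos_iff]
  positivity

theorem gg_lt (m s : ℝ) : gg m s < π / 2 := arctan_lt_pi_div_two _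

theorem gg_tan (m s : ℝ) : tan (gg m s) = sinh (s / m) := tan_arctan _

theorem gg_cos (m s : ℝ) : cos (gg m s) = 1 / cosh (s / m) := by
  unfold gg
  rw [cos_arctan, show 1 + sinh (s / m) ^ 2 = cosh (s / m) ^ 2 by rw [cosh_sq]; ring,
    sqrt_sq (cosh_pos _).le]

theorem gg_deriv {m : ℝ} (s : ℝ) :
    HasDerivAt (gg m) (1 / (m * cosh (s / m))) s := by
  have h1 : HasDerivAt (fun s : ℝ => s / m) (1 / m) s := (hasDerivAt_id s).div_const m
  have h2 := h1.sinh.arctan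
  refine h2.congr_deriv ?_
  rw [show 1 + sinh (s / m) ^ 2 = cosh (s / m) ^ 2 by rw [cosh_sq]; ring]
  have := (cosh_pos (s / m)).ne'
  field_simp

theorem gg_deriv2 {m : ℝ} (hm : 0 < m) (s : ℝ) :
    HasDerivAt (fun s => 1 / (m * cosh (s / m)))
      (- sinh (s / m) / (m ^ 2 * cosh (s / m) ^ 2)) s := by
  have h1 : HasDerivAt (fun s : ℝ => s / m) (1 / m) s := (hasDerivAt_id s).div_const m
  have hc := (cosh_pos (s / m)).ne'
  have h2 := (h1.cosh.const_mul m).inv (mul_ne_zero hm.ne' hc)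
  simp only [one_div]
  refine h2.congr_deriv ?_
  field_simp

theorem gg_arsinh {m φ : ℝ} (hm : 0 < m) (h1 : -(π / 2) < φ) (h2 : φ < π / 2) :
    gg m (m * arsinh (tan φ)) = φ := by
  unfold gg
  rw [mul_div_cancel_left₀ _ hm.ne', sinh_arsinh, arctan_tan h1 h2]

theorem le_arsinh_tan {φ : ℝ} (h1 : 0 ≤ φ) (h2 : φ < π / 2) : φ ≤ arsinh (tan φ) := by
  have hmono : ∀ t, 0 ≤ t → arctan (sinh t) ≤ t := by
    intro t ht
    have hd : ∀ s : ℝ, HasDerivAt (fun s => s - gg 1 s) (1 - 1 / (1 * cosh (s / 1))) s :=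
      fun s => (hasDerivAt_id s).sub (gg_deriv s)
    have hm : Monotone (fun s => s - gg 1 s) := monotone_of_hasDerivAt_nonneg hd (fun s => by
      have := one_le_cosh (s / 1)
      simp only [Pi.zero_apply, one_mul, sub_nonneg]
      rw [div_le_one (by linarith)]
      exact this)
    have := hm ht
    simp [gg] at this
    exact this
  have h3 := hmono (arsinh (tan φ)) (arsinh_nonneg_iff.2 (tan_nonneg_of_nonneg_of_le_pi_div_two h1 h2.le))
  rw [sinh_arsinh, arctan_tan (by linarith [pi_pos]) h2] at h3
  exact h3

theorem transfer {m : ℝ} (hm : 0 < m) {lam : ℝ} {h : ℝ × ℝ → ℝ}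
    (hC : ContinuousOn h (Icc 0 (π / m) ×ˢ Icc 0 (π / 2)))
    (h0 : ∀ φ ∈ Ioo 0 (π / 2), h (0, φ) = 0)
    (h1 : ∀ φ ∈ Ioo 0 (π / 2), h (π / m, φ) = 0)
    (hpos : ∀ p ∈ Ioo 0 (π / m) ×ˢ Ioo 0 (π / 2), 0 < h p)
    (hD : ContDiffOn ℝ 2 h (Ioo 0 (π / m) ×ˢ Ioo 0 (π / 2)))
    (hpde : ∀ p ∈ Ioo 0 (π / m) ×ˢ Ioo 0 (π / 2),
      pdy (pdy h) p - Real.tan p.2 * pdy h p + pdx (pdx h) p / Real.cos p.2 ^ 2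
      + lam * h p = 0) :
    Good (fun s => lam / m ^ 2 / cosh (s / m) ^ 2)
      (fun p => h (p.1 / m, gg m p.2))
      (fun p => pdy h (p.1 / m, gg m p.2) * (1 / (m * cosh (p.2 / m))))
      (fun p => pdy (pdy h) (p.1 / m, gg m p.2) * (1 / (m * cosh (p.2 / m)))
          * (1 / (m * cosh (p.2 / m)))
        + pdy h (p.1 / m, gg m p.2) * (- sinh (p.2 / m) / (m ^ 2 * cosh (p.2 / m) ^ 2)))
      (fun p => pdx h (p.1 / m, gg m p.2) * (1 / m))
      (fun p => pdx (pdx h) (p.1 / m, gg m p.2) * (1 / m) * (1 / m)) := by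
  set R : Set (ℝ × ℝ) := Ioo 0 (π / m) ×ˢ Ioo 0 (π / 2) with hR
  have hRo : IsOpen R := isOpen_Ioo.prod isOpen_Ioo
  have hD1 : ContDiffOn ℝ 1 (fderiv ℝ h) R := hD.fderiv_of_isOpen hRo (by norm_num)
  have hDx : ContDiffOn ℝ 1 (pdx h) R := hD1.clm_apply contDiffOn_const
  have hDy : ContDiffOn ℝ 1 (pdy h) R := hD1.clm_apply contDiffOn_const
  have hDyy : ContinuousOn (pdy (pdy h)) R :=
    ((hDy.fderiv_of_isOpen (m := 0) hRo (by norm_num)).clm_apply contDiffOn_const).continuousOn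
  have dh : ∀ p ∈ R, DifferentiableAt ℝ h p := fun p hp =>
    (hD.differentiableOn (by norm_num)).differentiableAt (hRo.mem_nhds hp)
  have dhx : ∀ p ∈ R, DifferentiableAt ℝ (pdx h) p := fun p hp =>
    (hDx.differentiableOn (by norm_num)).differentiableAt (hRo.mem_nhds hp)
  have dhy : ∀ p ∈ R, DifferentiableAt ℝ (pdy h) p := fun p hp =>
    (hDy.differentiableOn (by norm_num)).differentiableAt (hRo.mem_nhds hp)
  have hmem : ∀ x ∈ Ioo 0 π, ∀ s, 0 < s → (x / m, gg m s) ∈ R := by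
    intro x hx s hs
    refine ⟨⟨div_pos hx.1 hm, ?_⟩, gg_pos hm hs, gg_lt m s⟩
    exact div_lt_div_of_pos_right hx.2 hm
  have hmemC : ∀ x ∈ Icc 0 π, ∀ s, 0 < s →
      (x / m, gg m s) ∈ Icc 0 (π / m) ×ˢ Icc 0 (π / 2) := by
    intro x hx s hs
    refine ⟨⟨div_nonneg hx.1 hm.le, ?_⟩, (gg_pos hm hs).le, (gg_lt m s).le⟩
    exact div_le_div_of_nonneg_right hx.2 hm.le
  have hmap : Continuous (fun p : ℝ × ℝ => (p.1 / m, gg m p.2)) := by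
    have := gg_cont m
    fun_prop
  have hmR : MapsTo (fun p : ℝ × ℝ => (p.1 / m, gg m p.2)) (Ioo 0 π ×ˢ Ioi 0) R :=
    fun p hp => hmem p.1 hp.1 p.2 hp.2
  have hne : ∀ s : ℝ, m * cosh (s / m) ≠ 0 := fun s => mul_ne_zero hm.ne' (cosh_pos _).ne'
  have hgc : Continuous (fun p : ℝ × ℝ => 1 / (m * cosh (p.2 / m))) := by
    refine continuous_const.div (by fun_prop) (fun p => hne p.2)
  have hgc2 : Continuous (fun p : ℝ × ℝ => - sinh (p.2 / m) / (m ^ 2 * cosh (p.2 / m) ^ 2)) := by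
    refine Continuous.div (by fun_prop) (by fun_prop) (fun p => ?_)
    have := hne p.2
    rw [← mul_pow]
    exact pow_ne_zero 2 this
  have cy : ContinuousOn (fun p : ℝ × ℝ => pdy h (p.1 / m, gg m p.2)) (Ioo 0 π ×ˢ Ioi 0) :=
    hDy.continuousOn.comp hmap.continuousOn hmR
  have cyy : ContinuousOn (fun p : ℝ × ℝ => pdy (pdy h) (p.1 / m, gg m p.2)) (Ioo 0 π ×ˢ Ioi 0) :=
    hDyy.comp hmap.continuousOn hmR
  constructor
  · exact hC.comp hmap.continuousOn (fun p hp => hmemC p.1 hp.1 p.2 hp.2)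
  · intro s hs
    simpa using h0 _ ⟨gg_pos hm hs, gg_lt m s⟩
  · intro s hs
    exact h1 _ ⟨gg_pos hm hs, gg_lt m s⟩
  · exact fun x hx s hs => hpos _ (hmem x hx s hs)
  · exact fun x hx s hs => hasDerivAt_snd (dh _ (hmem x hx s hs)) (gg_deriv s)
  · exact fun x hx s hs =>
      (hasDerivAt_snd (dhy _ (hmem x hx s hs)) (gg_deriv s)).mul (gg_deriv2 hm s)
  · exact fun x hx s hs => hasDerivAt_fst (g := fun x => x / m) (dh _ (hmem x hx s hs))
      ((hasDerivAt_id x).div_const m)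
  · exact fun x hx s hs => (hasDerivAt_fst (g := fun x => x / m) (dhx _ (hmem x hx s hs))
      ((hasDerivAt_id x).div_const m)).mul_const _
  · exact cy.mul hgc.continuousOn
  · exact ((cyy.mul hgc.continuousOn).mul hgc.continuousOn).add (cy.mul hgc2.continuousOn)
  · intro x hx s hs
    have e := hpde _ (hmem x hx s hs)
    simp only [gg_tan, gg_cos] at e ⊢
    have hc := (cosh_pos (s / m)).ne'
    generalize pdy (pdy h) (x / m, gg m s) = a1 at *
    generalize pdx (pdx h) (x / m, gg m s) = a2 at *
    generalize pdy h (x / m, gg m s) = a3 at *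
    generalize h (x / m, gg m s) = a4 at *
    generalize cosh (s / m) = C at *
    generalize sinh (s / m) = S at *
    have e2 : a1 * (1 / (m * C)) * (1 / (m * C)) + a3 * (-S / (m ^ 2 * C ^ 2))
        + a2 * (1 / m) * (1 / m) + lam / m ^ 2 / C ^ 2 * a4 =
        (a1 - S * a3 + a2 / (1 / C) ^ 2 + lam * a4) / (m ^ 2 * C ^ 2) := by
      field_simp
      ring
    rw [e2, e, zero_div]
  · obtain ⟨B, hB⟩ := (isCompact_Icc.prod isCompact_Icc).exists_bound_of_continuousOn hC
    exact ⟨B, fun x hx s hs => hB _ (hmemC x hx s hs)⟩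

theorem mode_tendsto {m : ℝ} (hm : 0 < m) {h : ℝ × ℝ → ℝ}
    (hC : ContinuousOn h (Icc 0 (π / m) ×ˢ Icc 0 (π / 2)))
    (h0 : ∀ θ ∈ Icc 0 (π / m), h (θ, π / 2) = 0) :
    Tendsto (mode (fun p => h (p.1 / m, gg m p.2)) 1) atTop (nhds 0) := by
  obtain ⟨B, hB⟩ := (isCompact_Icc.prod isCompact_Icc).exists_bound_of_continuousOn hC
  have hmemC : ∀ x ∈ Icc 0 π, ∀ s, 0 < s →
      (x / m, gg m s) ∈ Icc 0 (π / m) ×ˢ Icc 0 (π / 2) := by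
    intro x hx s hs
    refine ⟨⟨div_nonneg hx.1 hm.le, ?_⟩, (gg_pos hm hs).le, (gg_lt m s).le⟩
    exact div_le_div_of_nonneg_right hx.2 hm.le
  have hπ := pi_pos
  have hgl : Tendsto (gg m) atTop (nhds (π / 2)) := by
    have h1 : Tendsto (fun s : ℝ => s / m) atTop atTop := tendsto_id.atTop_div_const hm
    have h2 : Tendsto sinh atTop atTop := by
      refine tendsto_atTop_mono' atTop ?_ tendsto_id
      filter_upwards [eventually_ge_atTop 0] with s hs
      exact self_le_sinh_iff.2 hs
    have h3 := tendsto_arctan_atTop.mono_right (nhdsWithin_le_nhds)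
    exact h3.comp (h2.comp h1)
  have key := intervalIntegral.tendsto_integral_filter_of_dominated_convergence
    (μ := MeasureTheory.volume) (a := 0) (b := π) (l := atTop)
    (F := fun s y => h (y / m, gg m s) * sin ((1:ℕ) * y)) (f := fun _ => 0) (fun _ => B) ?_ ?_ ?_ ?_
  · rw [intervalIntegral.integral_zero] at key
    exact key
  · filter_upwards [eventually_gt_atTop 0] with s hs
    have hc : ContinuousOn (fun y => h (y / m, gg m s) * sin ((1:ℕ) * y)) (Icc 0 π) := by
      refine ContinuousOn.mul ?_ (by fun_prop)
      exact hC.comp (f := fun y : ℝ => (y / m, gg m s)) (by fun_prop) (fun y hy => hmemC y hy s hs)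
    rw [uIoc_of_le hπ.le]
    exact (hc.mono Ioc_subset_Icc_self).aestronglyMeasurable measurableSet_Ioc
  · filter_upwards [eventually_gt_atTop 0] with s hs
    refine Eventually.of_forall fun y hy => ?_
    rw [uIoc_of_le hπ.le] at hy
    have h1 := hB _ (hmemC y (Ioc_subset_Icc_self hy) s hs)
    rw [norm_mul]
    have h2 : ‖sin ((1:ℕ) * y)‖ ≤ 1 := abs_sin_le_one _
    calc _ ≤ ‖h (y / m, gg m s)‖ * 1 := by gcongr
      _ ≤ B := by rw [mul_one]; exact h1
  · exact intervalIntegrable_const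
  · refine Eventually.of_forall fun y hy => ?_
    rw [uIoc_of_le hπ.le] at hy
    have hy' : y / m ∈ Icc 0 (π / m) :=
      ⟨div_nonneg hy.1.le hm.le, div_le_div_of_nonneg_right hy.2 hm.le⟩
    have h1 : Tendsto (fun s => (y / m, gg m s)) atTop
        (nhdsWithin (y / m, π / 2) (Icc 0 (π / m) ×ˢ Icc 0 (π / 2))) := by
      refine tendsto_nhdsWithin_iff.2 ⟨tendsto_const_nhds.prodMk_nhds hgl, ?_⟩
      filter_upwards [eventually_gt_atTop 0] with s hs
      exact hmemC y (Ioc_subset_Icc_self hy) s hs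
    have h2 := ((hC (y / m, π / 2) ⟨hy', by positivity, le_rfl⟩).tendsto.comp h1).mul_const
      (sin ((1:ℕ) * y))
    rw [h0 _ hy', zero_mul] at h2
    exact h2

end BH

/-- **Lemma 3.3 (boundary Harnack: `v` and `V`).** There are universal `0 < c ≤ C` such
that if `v` is a positive eigenfunction on the slit rectangle `Ω_{m,σ}` and `V` a positive
bounded eigenfunction on the sector `Ω' = (0, π/m) × (-a, π/2)` with the same eigenvalue
`μ(μ+1)`, `μ ∈ [m, m+1]`, both normalized by `∫₀^π ·(x/m, 1/m) sin x dx = π/2`, then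
`|v/V - l| ≤ C·e^{-cmφ}` on `Ω_{m,σ} ∩ {φ ≥ 1/m}` for some `l ∈ [c, C]`. -/
theorem boundary_harnack_v_V :
    ∃ c C : ℝ, 0 < c ∧ c ≤ C ∧
      ∀ m : ℕ, 1 ≤ m → ∀ σ ∈ Set.Icc (0 : ℝ) 1,
      ∀ μ : ℝ, (m : ℝ) ≤ μ → μ ≤ (m : ℝ) + 1 →
      ∀ v : ℝ × ℝ → ℝ, SphEigen m σ μ v → (∀ p ∈ OmegaSet m σ, 0 < v p) →
      (∫ x in (0 : ℝ)..π, v (x / m, 1 / m) * Real.sin x) = π / 2 →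
      ∀ a : ℝ, a ∈ Set.Ioc (0 : ℝ) (π / 2) →
      ∀ V : ℝ × ℝ → ℝ,
        ContinuousOn V (Set.Icc (0 : ℝ) (π / m) ×ˢ Set.Icc (-a) (π / 2)) →
        (∃ B : ℝ, ∀ p ∈ Set.Icc (0 : ℝ) (π / m) ×ˢ Set.Icc (-a) (π / 2), |V p| ≤ B) →
        (∀ p ∈ Set.Icc (0 : ℝ) (π / m) ×ˢ Set.Icc (-a) (π / 2),
          (p.1 = 0 ∨ p.1 = π / m ∨ p.2 = -a) → V p = 0) →
        (∀ p ∈ OmegaPrime m a, 0 < V p) →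
        ContDiffOn ℝ 2 V (OmegaPrime m a) →
        (∀ p ∈ OmegaPrime m a,
          pdy (pdy V) p - Real.tan p.2 * pdy V p + pdx (pdx V) p / Real.cos p.2 ^ 2
            + μ * (μ + 1) * V p = 0) →
        (∫ x in (0 : ℝ)..π, V (x / m, 1 / m) * Real.sin x) = π / 2 →
        ∃ l : ℝ, c ≤ l ∧ l ≤ C ∧
          ∀ p ∈ OmegaSet m σ, 1 / (m : ℝ) ≤ p.2 →
            |v p / V p - l| ≤ C * Real.exp (-c * m * p.2) := by
  obtain ⟨C, hC1, hmain⟩ := BH.abstract_main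
  refine ⟨1, C, one_pos, hC1, ?_⟩
  intro m hm1 σ hσ μ hμ1 hμ2 v hv hvpos hvn a ha V hVc _ hV0 hVpos hVD hVpde hVn
  obtain ⟨hvc, hv0, _, hvD, hvpde⟩ := hv
  have hm : (0:ℝ) < m := by exact_mod_cast hm1
  have hm1' : (1:ℝ) ≤ m := by exact_mod_cast hm1
  have hπ := pi_pos
  have hμ : 0 < μ := lt_of_lt_of_le hm hμ1
  have sub1 : Icc (0:ℝ) (π / m) ×ˢ Icc 0 (π / 2) ⊆ RectSet m :=
    prod_mono_right (Icc_subset_Icc_left (by linarith))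
  have sub2 : Icc (0:ℝ) (π / m) ×ˢ Icc 0 (π / 2) ⊆ Icc (0:ℝ) (π / m) ×ˢ Icc (-a) (π / 2) :=
    prod_mono_right (Icc_subset_Icc_left (by linarith [ha.1]))
  have sub3 : Ioo (0:ℝ) (π / m) ×ˢ Ioo 0 (π / 2) ⊆ OmegaSet m σ := by
    rintro p ⟨hp1, hp2⟩
    refine ⟨⟨hp1, by linarith [hp2.1], hp2.2⟩, ?_⟩
    rintro ⟨_, _, h⟩
    exact hp2.1.ne' h
  have sub4 : Ioo (0:ℝ) (π / m) ×ˢ Ioo 0 (π / 2) ⊆ OmegaPrime m a :=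
    prod_mono_right (Ioo_subset_Ioo_left (by linarith [ha.1]))
  have hm0 : (0:ℝ) ≤ π / m := by positivity
  have memL : ∀ φ ∈ Ioo (0:ℝ) (π / 2), ((0:ℝ), φ) ∈ Icc (0:ℝ) (π / m) ×ˢ Icc 0 (π / 2) :=
    fun φ hφ => ⟨⟨le_rfl, hm0⟩, hφ.1.le, hφ.2.le⟩
  have memR : ∀ φ ∈ Ioo (0:ℝ) (π / 2), (π / m, φ) ∈ Icc (0:ℝ) (π / m) ×ˢ Icc 0 (π / 2) :=
    fun φ hφ => ⟨⟨hm0, le_rfl⟩, hφ.1.le, hφ.2.le⟩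
  have Gv := BH.transfer hm (hvc.mono sub1)
    (fun φ hφ => hv0 _ (sub1 (memL φ hφ)) (Or.inl rfl))
    (fun φ hφ => hv0 _ (sub1 (memR φ hφ)) (Or.inr (Or.inl rfl)))
    (fun p hp => hvpos p (sub3 hp)) (hvD.mono sub3) (fun p hp => hvpde p (sub3 hp))
  have GV := BH.transfer hm (hVc.mono sub2)
    (fun φ hφ => hV0 _ (sub2 (memL φ hφ)) (Or.inl rfl))
    (fun φ hφ => hV0 _ (sub2 (memR φ hφ)) (Or.inr (Or.inl rfl)))
    (fun p hp => hVpos p (sub4 hp)) (hVD.mono sub4) (fun p hp => hVpde p (sub4 hp))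
  have hlim := BH.mode_tendsto hm (hvc.mono sub1) (fun θ hθ =>
    hv0 _ (sub1 ⟨hθ, by positivity, le_rfl⟩) (Or.inr (Or.inr (Or.inr rfl))))
  have hinv : (0:ℝ) < 1 / m := by positivity
  have hinv1 : (1:ℝ) / m < π / 2 := by
    have : (1:ℝ) / m ≤ 1 := (div_le_one hm).2 hm1'
    linarith [pi_gt_three]
  have hg1 : BH.gg m (m * arsinh (tan (1 / m))) = 1 / m :=
    BH.gg_arsinh hm (by linarith) hinv1
  have hs1 : 0 < (m:ℝ) * arsinh (tan (1 / m)) := by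
    have := BH.le_arsinh_tan hinv.le hinv1
    exact mul_pos hm (by linarith)
  have hnorm : BH.mode (fun p => v (p.1 / m, BH.gg m p.2)) 1 (m * arsinh (tan (1 / m))) =
      BH.mode (fun p => V (p.1 / m, BH.gg m p.2)) 1 (m * arsinh (tan (1 / m))) := by
    simp only [BH.mode, hg1, Nat.cast_one, one_mul]
    rw [hvn, hVn]
  have hl0 : 0 ≤ μ * (μ + 1) / (m:ℝ) ^ 2 := by positivity
  have hfin := hmain _ (μ * (μ + 1) / (m:ℝ) ^ 2) ?_ ?_ ?_ _ _ _ _ _ _ _ _ _ _ Gv GV hlim _ hs1 hnorm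
  · refine ⟨1, le_rfl, hC1, ?_⟩
    intro p hp hp2
    obtain ⟨⟨hpx, hpy⟩, _⟩ := hp
    have hp0 : 0 ≤ p.2 := hinv.le.trans hp2
    have hle := BH.le_arsinh_tan hp0 hpy.2
    have hle2 : (m:ℝ) * p.2 ≤ m * arsinh (tan p.2) := by gcongr
    have hle3 : 1 ≤ (m:ℝ) * p.2 := by
      rw [div_le_iff₀ hm] at hp2
      linarith
    have hx : (m:ℝ) * p.1 ∈ Ioo 0 π := by
      refine ⟨mul_pos hm hpx.1, ?_⟩
      have := (lt_div_iff₀ hm).1 hpx.2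
      linarith
    have := hfin _ hx (m * arsinh (tan p.2)) (by linarith)
    simp only [BH.gg_arsinh hm hpy.1 hpy.2, mul_div_cancel_left₀ _ hm.ne', Prod.mk.eta] at this
    refine this.trans ?_
    gcongr
    linarith
  · refine Continuous.div (by fun_prop) (by fun_prop) (fun s => ?_)
    exact pow_ne_zero 2 (cosh_pos _).ne'
  · intro s
    positivity
  · intro s
    refine div_le_self hl0 ?_
    exact one_le_pow₀ (one_le_cosh _)
end

section
/- There exist constants α ∈ (0, 1) and C > 0, independent of σ, with the following property: for every σ ∈ [0, π] and every continuous function v : [0, π] × [−2, 2] → ℝ with |v| ≤ 1, vanishing on the set F := ([0, σ] × {0}) ∪ ({0, π} × [−2, 2]), which is C² and satisfies ∂²_x v + ∂²_y v + v = 0 on ((0, π) × (−2, 2)) \ F, one has |v(p) − v(q)| ≤ C·|p − q|^α for all p, q ∈ [0, π] × [−1, 1]. -/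
open Real Set Filter

/-- The slit together with the vertical sides of the rectangle `[0, π] × [-2, 2]`:
`F = ([0, σ] × {0}) ∪ ({0, π} × [-2, 2])`. -/
def Fset (σ : ℝ) : Set (ℝ × ℝ) :=
  {p : ℝ × ℝ | 0 ≤ p.1 ∧ p.1 ≤ σ ∧ p.2 = 0} ∪
    {p : ℝ × ℝ | (p.1 = 0 ∨ p.1 = π) ∧ -2 ≤ p.2 ∧ p.2 ≤ 2}


/-- Second-order necessary condition at a local maximum. -/
lemma sec_nonpos {g g' : ℝ → ℝ} {G : ℝ} (h1 : ∀ᶠ t in nhds (0:ℝ), HasDerivAt g (g' t) t)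
    (h2 : HasDerivAt g' G 0) (hm : IsLocalMax g 0) : G ≤ 0 := by
  by_contra hG
  push Not at hG
  have e1 : deriv g =ᶠ[nhds 0] g' := h1.mono fun t ht => ht.deriv
  have d2 : deriv (deriv g) 0 = G := by rw [e1.deriv_eq]; exact h2.deriv
  have hmin := isLocalMin_of_deriv_deriv_pos (f := g) (x₀ := 0) (by rw [d2]; exact hG)
    hm.deriv_eq_zero h1.self_of_nhds.continuousAt
  have hc : g =ᶠ[nhds 0] fun _ => g 0 := by
    filter_upwards [hm, hmin] with t a b using le_antisymm a b
  have e2 : deriv g =ᶠ[nhds 0] fun _ => (0:ℝ) := by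
    have := hc.deriv
    filter_upwards [this] with t ht
    rw [ht]; simp
  rw [e2.deriv_eq] at d2
  simp at d2
  linarith

/-- Second directional derivative. -/
noncomputable def D2 (v : ℝ × ℝ → ℝ) (p e : ℝ × ℝ) : ℝ := fderiv ℝ (fderiv ℝ v) p e e

lemma line_deriv {v : ℝ × ℝ → ℝ} {p : ℝ × ℝ} (hv : ContDiffAt ℝ 2 v p) (e : ℝ × ℝ) :
    (∀ᶠ t in nhds (0:ℝ), HasDerivAt (fun t : ℝ => v (p + t • e)) (fderiv ℝ v (p + t • e) e) t) ∧
    HasDerivAt (fun t : ℝ => fderiv ℝ v (p + t • e) e) (D2 v p e) 0 := by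
  have hl : ∀ t : ℝ, HasDerivAt (fun t : ℝ => p + t • e) e t := by
    intro t
    simpa using ((hasDerivAt_id t).smul_const e).const_add p
  have hc : Tendsto (fun t : ℝ => p + t • e) (nhds 0) (nhds p) := by
    have := (hl 0).continuousAt.tendsto
    simpa using this
  have hev : ∀ᶠ q in nhds p, DifferentiableAt ℝ v q := by
    have := hv.eventually (by simp)
    exact this.mono fun q hq => hq.differentiableAt (by simp)
  constructor
  · filter_upwards [hc.eventually hev] with t ht
    exact ht.hasFDerivAt.comp_hasDerivAt t (hl t)
  · have h1 : DifferentiableAt ℝ (fderiv ℝ v) p :=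
      (hv.fderiv_right (m := 1) (by norm_num)).differentiableAt (by simp)
    have h2 : HasFDerivAt (fderiv ℝ v) (fderiv ℝ (fderiv ℝ v) p) (p + (0:ℝ) • e) := by
      simpa using h1.hasFDerivAt
    have h3 := h2.comp_hasDerivAt (0:ℝ) (hl 0)
    have h4 := h3.clm_apply (hasDerivAt_const (0:ℝ) e)
    simpa [D2] using h4

lemma D2_expand (v : ℝ × ℝ → ℝ) {p : ℝ × ℝ} (hv : ContDiffAt ℝ 2 v p) :
    ∃ m : ℝ, ∀ c d : ℝ, D2 v p (c, d) =
      c ^ 2 * pdx (pdx v) p + c * d * m + d ^ 2 * pdy (pdy v) p := by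
  have h1 : DifferentiableAt ℝ (fderiv ℝ v) p :=
      (hv.fderiv_right (m := 1) (by norm_num)).differentiableAt (by simp)
  have hx : pdx (pdx v) p = fderiv ℝ (fderiv ℝ v) p (1, 0) (1, 0) := by
    have := (h1.hasFDerivAt.clm_apply (hasFDerivAt_const ((1:ℝ), (0:ℝ)) p)).fderiv
    unfold pdx
    rw [this]; simp
  have hy : pdy (pdy v) p = fderiv ℝ (fderiv ℝ v) p (0, 1) (0, 1) := by
    have := (h1.hasFDerivAt.clm_apply (hasFDerivAt_const ((0:ℝ), (1:ℝ)) p)).fderiv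
    unfold pdy
    rw [this]; simp
  refine ⟨fderiv ℝ (fderiv ℝ v) p (1, 0) (0, 1) + fderiv ℝ (fderiv ℝ v) p (0, 1) (1, 0), ?_⟩
  intro c d
  have : ((c, d) : ℝ × ℝ) = c • (1, 0) + d • (0, 1) := by simp
  rw [hx, hy, D2, this]
  simp only [map_add, map_smul, add_apply, smul_apply,
    smul_eq_mul]
  ring

noncomputable def rr (x y : ℝ) : ℝ := √(x ^ 2 + y ^ 2)
noncomputable def hh (x y : ℝ) : ℝ := rr x y + x
/-- The barrier `(r + x)^{1/4}`. -/
noncomputable def W (x y : ℝ) : ℝ := hh x y ^ (1 / 4 : ℝ)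

lemma rr_sq (x y : ℝ) : rr x y ^ 2 = x ^ 2 + y ^ 2 := Real.sq_sqrt (by positivity)
lemma rr_nonneg (x y : ℝ) : 0 ≤ rr x y := Real.sqrt_nonneg _
lemma abs_le_rr (x y : ℝ) : |x| ≤ rr x y := Real.abs_le_sqrt (by nlinarith [sq_nonneg y])
lemma hh_nonneg (x y : ℝ) : 0 ≤ hh x y := by
  have := abs_le_rr x y
  have := neg_abs_le x
  unfold hh; linarith
lemma hh_le (x y : ℝ) : hh x y ≤ 2 * rr x y := by
  have := abs_le_rr x y
  have := le_abs_self x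
  unfold hh; linarith
lemma rr_pos {x y : ℝ} (h : 0 < hh x y) : 0 < rr x y := by
  have := hh_le x y
  linarith
lemma hh_pos {x y : ℝ} (h : ¬ (x ≤ 0 ∧ y = 0)) : 0 < hh x y := by
  rcases (hh_nonneg x y).lt_or_eq with h1 | h1
  · exact h1
  · exfalso
    apply h
    have h2 := rr_sq x y
    have h3 := rr_nonneg x y
    have h4 : rr x y = -x := by unfold hh at h1; linarith
    rw [h4] at h2 h3
    exact ⟨by linarith, by nlinarith⟩
lemma hh_mul (x y : ℝ) : hh x y * (rr x y - x) = y ^ 2 := by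
  have := rr_sq x y
  unfold hh; linarith

lemma rr_cont : Continuous fun p : ℝ × ℝ => rr p.1 p.2 := by unfold rr; fun_prop
lemma hh_cont : Continuous fun p : ℝ × ℝ => hh p.1 p.2 := by unfold hh; exact rr_cont.add continuous_fst
lemma W_cont : Continuous fun p : ℝ × ℝ => W p.1 p.2 := by
  unfold W; exact hh_cont.rpow_const (fun _ => Or.inr (by norm_num))

lemma rr_dx {x y : ℝ} (h : 0 < rr x y) : HasDerivAt (fun t => rr t y) (x / rr x y) x := by
  have h0 : x ^ 2 + y ^ 2 ≠ 0 := by rw [← rr_sq]; positivity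
  have h1 : HasDerivAt (fun t : ℝ => t ^ 2) (2 * x) x := by simpa using hasDerivAt_pow 2 x
  have := (h1.add_const (y ^ 2)).sqrt h0
  have e : 2 * x / (2 * √(x ^ 2 + y ^ 2)) = x / rr x y := by
    unfold rr; rw [mul_div_mul_left _ _ (two_ne_zero)]
  rw [e] at this
  exact this
lemma rr_dy {x y : ℝ} (h : 0 < rr x y) : HasDerivAt (fun t => rr x t) (y / rr x y) y := by
  have h0 : x ^ 2 + y ^ 2 ≠ 0 := by rw [← rr_sq]; positivity
  have h1 : HasDerivAt (fun t : ℝ => t ^ 2) (2 * y) y := by simpa using hasDerivAt_pow 2 y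
  have := (h1.const_add (x ^ 2)).sqrt h0
  have e : 2 * y / (2 * √(x ^ 2 + y ^ 2)) = y / rr x y := by
    unfold rr; rw [mul_div_mul_left _ _ (two_ne_zero)]
  rw [e] at this
  exact this
lemma hh_dx {x y : ℝ} (h : 0 < rr x y) : HasDerivAt (fun t => hh t y) (x / rr x y + 1) x :=
  (rr_dx h).add (hasDerivAt_id x)
lemma hh_dy {x y : ℝ} (h : 0 < rr x y) : HasDerivAt (fun t => hh x t) (y / rr x y) y :=
  (rr_dy h).add_const x

lemma W_dx {x y : ℝ} (h : 0 < hh x y) :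
    HasDerivAt (fun t => W t y) (W x y / (4 * rr x y)) x := by
  have hr := rr_pos h
  refine ((hh_dx hr).rpow_const (p := (1 / 4 : ℝ)) (Or.inl h.ne')).congr_deriv ?_
  rw [Real.rpow_sub_one h.ne']
  have : hh x y = rr x y + x := rfl
  have e : x / rr x y + 1 = hh x y / rr x y := by rw [this]; field_simp; ring
  rw [e]; unfold W; field_simp
lemma W_dy {x y : ℝ} (h : 0 < hh x y) :
    HasDerivAt (fun t => W x t) (W x y * y / (4 * (hh x y * rr x y))) y := by
  have hr := rr_pos h
  refine ((hh_dy hr).rpow_const (p := (1 / 4 : ℝ)) (Or.inl h.ne')).congr_deriv ?_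
  rw [Real.rpow_sub_one h.ne']
  unfold W; field_simp

lemma W_lap {x y : ℝ} (h : 0 < hh x y) : ∃ a b : ℝ,
    HasDerivAt (fun t => W t y / (4 * rr t y)) a x ∧
    HasDerivAt (fun t => W x t * t / (4 * (hh x t * rr x t))) b y ∧
    a + b = - W x y / (8 * (hh x y * rr x y)) := by
  have hr := rr_pos h
  refine ⟨_, _, (W_dx h).div ((rr_dx hr).const_mul 4) (by positivity),
    ((W_dy h).mul (hasDerivAt_id y)).div (((hh_dy hr).mul (rr_dy hr)).const_mul 4) (by positivity), ?_⟩
  simp only [id, Pi.mul_apply]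
  have e1 := hh_mul x y
  have e2 : x = hh x y - rr x y := by unfold hh; ring
  generalize hh x y = H at *
  generalize rr x y = r at *
  generalize W x y = w at *
  have e3 : y ^ 2 = H * (2 * r - H) := by rw [← e1, e2]; ring
  subst e2
  field_simp
  linear_combination (-32 * w * H - 24 * w * r) * e3


def Rect : Set (ℝ × ℝ) := Set.Icc (0 : ℝ) π ×ˢ Set.Icc (-2 : ℝ) 2
def Om (σ : ℝ) : Set (ℝ × ℝ) := (Set.Ioo (0 : ℝ) π ×ˢ Set.Ioo (-2 : ℝ) 2) \ Fset σ

/-- The hypotheses on `v`. -/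
def Sol (σ : ℝ) (v : ℝ × ℝ → ℝ) : Prop :=
  ContinuousOn v Rect ∧ (∀ p ∈ Rect, |v p| ≤ 1) ∧ (∀ p ∈ Fset σ, v p = 0) ∧
    (∀ p ∈ Om σ, ContDiffAt ℝ 2 v p) ∧
    ∀ p ∈ Om σ, pdx (pdx v) p + pdy (pdy v) p + v p = 0

lemma Fset_closed (σ : ℝ) : IsClosed (Fset σ) := by
  unfold Fset
  apply IsClosed.union
  · exact (isClosed_le continuous_const continuous_fst).inter
      ((isClosed_le continuous_fst continuous_const).inter
        (isClosed_eq continuous_snd continuous_const))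
  · exact ((isClosed_eq continuous_fst continuous_const).union
      (isClosed_eq continuous_fst continuous_const)).inter
      ((isClosed_le continuous_const continuous_snd).inter
        (isClosed_le continuous_snd continuous_const))

lemma Om_open (σ : ℝ) : IsOpen (Om σ) :=
  (isOpen_Ioo.prod isOpen_Ioo).sdiff (Fset_closed σ)

lemma Om_sub (σ : ℝ) : Om σ ⊆ Rect := by
  rintro p ⟨⟨⟨h1, h2⟩, h3, h4⟩, _⟩
  exact ⟨⟨h1.le, h2.le⟩, h3.le, h4.le⟩

lemma Rect_compact : IsCompact Rect := isCompact_Icc.prod isCompact_Icc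

lemma mem_Om {σ : ℝ} {p : ℝ × ℝ} (hp : p ∈ Rect) (hF : p ∉ Fset σ) (h2 : |p.2| < 2) :
    p ∈ Om σ := by
  obtain ⟨⟨a, b⟩, c, d⟩ := hp
  rw [abs_lt] at h2
  refine ⟨⟨⟨lt_of_le_of_ne a ?_, lt_of_le_of_ne b ?_⟩, h2⟩, hF⟩
  · intro h; exact hF (Or.inr ⟨Or.inl h.symm, c, d⟩)
  · intro h; exact hF (Or.inr ⟨Or.inr h, c, d⟩)

lemma Sol.neg {σ : ℝ} {v : ℝ × ℝ → ℝ} (h : Sol σ v) : Sol σ (fun p => - v p) := by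
  obtain ⟨h1, h2, h3, h4, h5⟩ := h
  refine ⟨h1.neg, fun p hp => by simpa using h2 p hp, fun p hp => by simp [h3 p hp],
    fun p hp => (h4 p hp).neg, fun p hp => ?_⟩
  have e1 : ∀ f : ℝ × ℝ → ℝ, pdx (fun q => - f q) = fun q => - pdx f q := by
    intro f; funext q; unfold pdx; rw [fderiv_fun_neg]; simp
  have e2 : ∀ f : ℝ × ℝ → ℝ, pdy (fun q => - f q) = fun q => - pdy f q := by
    intro f; funext q; unfold pdy; rw [fderiv_fun_neg]; simp
  simp only [e1, e2]
  linarith [h5 p hp]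

lemma Om_line {σ : ℝ} {p : ℝ × ℝ} (hp : p ∈ Om σ) (e : ℝ × ℝ) :
    ∀ᶠ t in nhds (0:ℝ), p + t • e ∈ Rect := by
  have hc : Continuous (fun t : ℝ => p + t • e) := by fun_prop
  have := hc.tendsto 0
  simp only [zero_smul, add_zero] at this
  exact (this.eventually ((Om_open σ).mem_nhds hp)).mono fun t ht => Om_sub σ ht

lemma W_nonneg (x y : ℝ) : 0 ≤ W x y := Real.rpow_nonneg (hh_nonneg x y) _

lemma W_ge {x y : ℝ} (h : hh x y ≤ 10) : hh x y / 10 ≤ W x y := by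
  have h0 := hh_nonneg x y
  have h1 : hh x y / 10 ≤ (hh x y / 10) ^ (1 / 4 : ℝ) := by
    have := Real.rpow_le_rpow_of_exponent_ge' (x := hh x y / 10) (by positivity) (by linarith)
      (z := 1 / 4) (y := 1) (by norm_num) (by norm_num)
    simpa using this
  exact h1.trans (Real.rpow_le_rpow (by positivity) (by linarith) (by norm_num))

lemma barrier {σ : ℝ} {v : ℝ × ℝ → ℝ} (hS : Sol σ v) {a b s : ℝ} (hs : s = 1 ∨ s = -1)
    (ha : a ∈ Set.Icc 0 π) (hb : |b| ≤ 3 / 2)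
    (hg : ∀ p ∈ Om σ, ¬ (s * (p.1 - a) ≤ 0 ∧ p.2 - b = 0)) :
    ∀ p ∈ Rect, v p ≤ 1000 * W (s * (p.1 - a)) (p.2 - b) := by
  obtain ⟨h1, h2, h3, h4, h5⟩ := hS
  have hcW : Continuous fun p : ℝ × ℝ => W (s * (p.1 - a)) (p.2 - b) :=
    W_cont.comp (f := fun p : ℝ × ℝ => (s * (p.1 - a), p.2 - b)) (by fun_prop)
  obtain ⟨p, hp, hmax⟩ := Rect_compact.exists_isMaxOn (f := fun p => v p - 1000 *
    W (s * (p.1 - a)) (p.2 - b)) ⟨(0, 0), ⟨le_rfl, Real.pi_pos.le⟩, by norm_num, by norm_num⟩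
    (h1.sub (hcW.const_mul 1000).continuousOn)
  have hmax' : ∀ q ∈ Rect, v q - 1000 * W (s * (q.1 - a)) (q.2 - b) ≤
    v p - 1000 * W (s * (p.1 - a)) (p.2 - b) := fun q hq => hmax hq
  suffices hsuff : v p - 1000 * W (s * (p.1 - a)) (p.2 - b) ≤ 0 by
    intro q hq
    linarith [hmax' q hq]
  by_cases hF : p ∈ Fset σ
  · rw [h3 p hF]
    linarith [W_nonneg (s * (p.1 - a)) (p.2 - b)]
  have hs2 : s ^ 2 = 1 := by rcases hs with rfl | rfl <;> norm_num
  have hvp := abs_le.1 (h2 p hp)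
  obtain ⟨⟨p1, p2⟩, p3, p4⟩ := id hp
  obtain ⟨hb1, hb2⟩ := abs_le.1 hb
  have hpi := Real.pi_lt_d2
  have hr5 : rr (s * (p.1 - a)) (p.2 - b) ≤ 5 := by
    apply Real.sqrt_le_iff.2 ⟨by norm_num, ?_⟩
    have q1 : (s * (p.1 - a)) ^ 2 ≤ 3.15 ^ 2 := by
      rw [mul_pow, hs2, one_mul]
      apply sq_le_sq'
      · linarith [ha.2]
      · linarith [ha.1]
    have q2 : (p.2 - b) ^ 2 ≤ 3.5 ^ 2 := by
      apply sq_le_sq' <;> linarith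
    linarith
  have hh10 : hh (s * (p.1 - a)) (p.2 - b) ≤ 10 := by
    linarith [hh_le (s * (p.1 - a)) (p.2 - b)]
  have hWge := W_ge hh10
  by_cases h22 : |p.2| < 2
  swap
  · -- top and bottom
    have hY : 1 / 4 ≤ (p.2 - b) ^ 2 := by
      rcases le_abs.1 (not_lt.1 h22) with h | h <;> nlinarith
    have e := hh_mul (s * (p.1 - a)) (p.2 - b)
    have := abs_le_rr (s * (p.1 - a)) (p.2 - b)
    have := neg_abs_le (s * (p.1 - a))
    have h0 := hh_nonneg (s * (p.1 - a)) (p.2 - b)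
    have : 1 / 4 ≤ hh (s * (p.1 - a)) (p.2 - b) * 10 := by
      refine (hY.trans e.symm.le).trans (mul_le_mul_of_nonneg_left ?_ h0)
      linarith
    linarith
  have hpO := mem_Om hp hF h22
  have hpos := hh_pos (hg p hpO)
  exfalso
  obtain ⟨A, B, hA, hB, hAB⟩ := W_lap hpos
  set X := s * (p.1 - a) with hX
  set Y := p.2 - b with hY
  have hr := rr_pos hpos
  obtain ⟨m, hm⟩ := D2_expand v (h4 p hpO)
  -- x direction
  have dx : D2 v p (s, 0) ≤ 1000 * A := by
    obtain ⟨l1, l2⟩ := line_deriv (h4 p hpO) (s, 0)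
    have tc : Tendsto (fun t : ℝ => X + t) (nhds 0) (nhds X) := by
      have : Continuous (fun t : ℝ => X + t) := by fun_prop
      simpa using this.tendsto 0
    have hev : ∀ᶠ t in nhds (0:ℝ), 0 < hh (X + t) Y := by
      have : Continuous fun t : ℝ => hh (X + t) Y :=
        hh_cont.comp (f := fun t : ℝ => (X + t, Y)) (by fun_prop)
      exact this.continuousAt.eventually (lt_mem_nhds (by simpa using hpos))
    have k := sec_nonpos (g := fun t => v (p + t • (s, 0)) - 1000 * W (X + t) Y)
      (g' := fun t => fderiv ℝ v (p + t • (s, 0)) (s, 0) - 1000 * (W (X + t) Y / (4 * rr (X + t) Y)))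
      (G := D2 v p (s, 0) - 1000 * A) ?_ ?_ ?_
    · linarith
    · filter_upwards [l1, hev] with t ht1 ht2
      exact ht1.sub (((W_dx ht2).comp_const_add X t).const_mul 1000)
    · refine l2.sub (HasDerivAt.const_mul 1000 ?_)
      exact HasDerivAt.comp_const_add X 0 (by simpa using hA)
    · filter_upwards [Om_line hpO (s, 0)] with t ht
      have := hmax' _ ht
      have e : s * ((p + t • ((s, 0) : ℝ × ℝ)).1 - a) = X + t := by
        simp; linear_combination t * hs2
      have e' : (p + t • ((s, 0) : ℝ × ℝ)).2 - b = Y := by simp [hY]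
      rw [e, e'] at this
      simpa using this
  have dy : D2 v p (0, 1) ≤ 1000 * B := by
    obtain ⟨l1, l2⟩ := line_deriv (h4 p hpO) (0, 1)
    have hev : ∀ᶠ t in nhds (0:ℝ), 0 < hh X (Y + t) := by
      have : Continuous fun t : ℝ => hh X (Y + t) :=
        hh_cont.comp (f := fun t : ℝ => (X, Y + t)) (by fun_prop)
      exact this.continuousAt.eventually (lt_mem_nhds (by simpa using hpos))
    have k := sec_nonpos (g := fun t => v (p + t • (0, 1)) - 1000 * W X (Y + t))
      (g' := fun t => fderiv ℝ v (p + t • (0, 1)) (0, 1) -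
        1000 * (W X (Y + t) * (Y + t) / (4 * (hh X (Y + t) * rr X (Y + t)))))
      (G := D2 v p (0, 1) - 1000 * B) ?_ ?_ ?_
    · linarith
    · filter_upwards [l1, hev] with t ht1 ht2
      exact ht1.sub (((W_dy ht2).comp_const_add Y t).const_mul 1000)
    · refine l2.sub (HasDerivAt.const_mul 1000 ?_)
      exact HasDerivAt.comp_const_add (f := fun t => W X t * t / (4 * (hh X t * rr X t))) Y 0
        (by simpa using hB)
    · filter_upwards [Om_line hpO (0, 1)] with t ht
      have := hmax' _ ht
      have e : s * ((p + t • ((0, 1) : ℝ × ℝ)).1 - a) = X := by simp [hX]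
      have e' : (p + t • ((0, 1) : ℝ × ℝ)).2 - b = Y + t := by simp [hY]; ring
      rw [e, e'] at this
      simpa using this
  rw [hm] at dx dy
  have eq := h5 p hpO
  rw [hs2] at dx
  have hlap : A + B ≤ - (1 / 400) := by
    rw [hAB, neg_div, neg_le_neg_iff, le_div_iff₀ (by positivity)]
    nlinarith
  linarith

lemma W_le (x y : ℝ) : W x y ≤ 2 * rr x y ^ (1 / 4 : ℝ) := by
  have h1 : W x y ≤ (2 * rr x y) ^ (1 / 4 : ℝ) :=
    Real.rpow_le_rpow (hh_nonneg x y) (hh_le x y) (by norm_num)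
  rw [Real.mul_rpow (by norm_num) (rr_nonneg x y)] at h1
  refine h1.trans (mul_le_mul_of_nonneg_right ?_ (Real.rpow_nonneg (rr_nonneg x y) _))
  have := Real.rpow_le_rpow_of_exponent_le (x := 2) (by norm_num) (show (1/4:ℝ) ≤ 1 by norm_num)
  simpa using this

lemma decay {σ : ℝ} {v : ℝ × ℝ → ℝ} (hσ : σ ∈ Set.Icc 0 π) (hS : Sol σ v) {z : ℝ × ℝ}
    (hz : z ∈ Fset σ) (hz2 : |z.2| ≤ 3 / 2) {p : ℝ × ℝ} (hp : p ∈ Rect) :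
    v p ≤ 2000 * rr (p.1 - z.1) (p.2 - z.2) ^ (1 / 4 : ℝ) := by
  rcases hz with ⟨z1, z2, z3⟩ | ⟨z1 | z1, z2, z3⟩
  · have := barrier hS (a := z.1) (b := z.2) (s := 1) (Or.inl rfl) ⟨z1, z2.trans hσ.2⟩ hz2 (by
      rintro q ⟨⟨⟨q1, q2⟩, q3, q4⟩, q5⟩ ⟨q6, q7⟩
      exact q5 (Or.inl ⟨q1.le, by linarith, by linarith⟩)) p hp
    rw [one_mul] at this
    linarith [W_le (p.1 - z.1) (p.2 - z.2)]
  · have := barrier hS (a := z.1) (b := z.2) (s := 1) (Or.inl rfl)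
      ⟨z1.ge, by rw [z1]; exact Real.pi_pos.le⟩ hz2 (by
      rintro q ⟨⟨⟨q1, q2⟩, q3, q4⟩, q5⟩ ⟨q6, q7⟩
      linarith) p hp
    rw [one_mul] at this
    linarith [W_le (p.1 - z.1) (p.2 - z.2)]
  · have := barrier hS (a := z.1) (b := z.2) (s := -1) (Or.inr rfl)
      ⟨by rw [z1]; exact Real.pi_pos.le, z1.le⟩ hz2 (by
      rintro q ⟨⟨⟨q1, q2⟩, q3, q4⟩, q5⟩ ⟨q6, q7⟩
      linarith) p hp
    have e : rr (-1 * (p.1 - z.1)) (p.2 - z.2) = rr (p.1 - z.1) (p.2 - z.2) := by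
      unfold rr; congr 1; ring
    have h := W_le (-1 * (p.1 - z.1)) (p.2 - z.2)
    rw [e] at h
    linarith

lemma rr_symm (x y x' y' : ℝ) : rr (x - x') (y - y') = rr (x' - x) (y' - y) := by
  unfold rr; congr 1; ring

lemma doubling {σ : ℝ} {v : ℝ × ℝ → ℝ} (hσ : σ ∈ Set.Icc 0 π) (hS : Sol σ v) {y0 : ℝ}
    (hy0 : |y0| ≤ 1) : ∀ p ∈ Rect, ∀ q ∈ Rect,
    v p - v q - 2000 * rr (p.1 - q.1) (p.2 - q.2) ^ (1 / 4 : ℝ) - 32 * (p.2 - y0) ^ 2 ≤ 0 := by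
  have hS' := hS
  obtain ⟨h1, h2, h3, h4, h5⟩ := hS
  have hc : ContinuousOn (fun z : (ℝ × ℝ) × (ℝ × ℝ) => v z.1 - v z.2 -
      2000 * rr (z.1.1 - z.2.1) (z.1.2 - z.2.2) ^ (1 / 4 : ℝ) - 32 * (z.1.2 - y0) ^ 2)
      (Rect ×ˢ Rect) := by
    have c1 : ContinuousOn (fun z : (ℝ × ℝ) × (ℝ × ℝ) => v z.1) (Rect ×ˢ Rect) :=
      h1.comp continuous_fst.continuousOn (fun z hz => hz.1)
    have c2 : ContinuousOn (fun z : (ℝ × ℝ) × (ℝ × ℝ) => v z.2) (Rect ×ˢ Rect) :=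
      h1.comp continuous_snd.continuousOn (fun z hz => hz.2)
    have c3 : Continuous (fun z : (ℝ × ℝ) × (ℝ × ℝ) =>
        rr (z.1.1 - z.2.1) (z.1.2 - z.2.2) ^ (1 / 4 : ℝ)) :=
      (rr_cont.comp (f := fun z : (ℝ × ℝ) × (ℝ × ℝ) => (z.1.1 - z.2.1, z.1.2 - z.2.2))
        (by fun_prop)).rpow_const (fun _ => Or.inr (by norm_num))
    have c4 : Continuous (fun z : (ℝ × ℝ) × (ℝ × ℝ) => 32 * (z.1.2 - y0) ^ 2) := by fun_prop
    exact ((c1.sub c2).sub (c3.const_mul 2000).continuousOn).sub c4.continuousOn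
  have h00 : ((0, 0) : ℝ × ℝ) ∈ Rect := ⟨⟨le_rfl, Real.pi_pos.le⟩, by norm_num, by norm_num⟩
  obtain ⟨⟨p, q⟩, ⟨hp, hq⟩, hmax⟩ := (Rect_compact.prod Rect_compact).exists_isMaxOn
    ⟨((0, 0), (0, 0)), h00, h00⟩ hc
  have hmax' : ∀ p' ∈ Rect, ∀ q' ∈ Rect, v p' - v q' -
      2000 * rr (p'.1 - q'.1) (p'.2 - q'.2) ^ (1 / 4 : ℝ) - 32 * (p'.2 - y0) ^ 2 ≤
      v p - v q - 2000 * rr (p.1 - q.1) (p.2 - q.2) ^ (1 / 4 : ℝ) - 32 * (p.2 - y0) ^ 2 :=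
    fun p' hp' q' hq' => hmax (show (p', q') ∈ Rect ×ˢ Rect from ⟨hp', hq'⟩)
  by_contra hcon
  have hpos : 0 < v p - v q - 2000 * rr (p.1 - q.1) (p.2 - q.2) ^ (1 / 4 : ℝ) -
      32 * (p.2 - y0) ^ 2 := by
    push Not at hcon
    obtain ⟨p', hp', q', hq', h⟩ := hcon
    exact h.trans_le (hmax' p' hp' q' hq')
  clear hcon hmax hc
  simp only at hp hq
  set r := rr (p.1 - q.1) (p.2 - q.2) with hr
  have hr0 : 0 ≤ r := rr_nonneg _ _
  have hrq : 0 ≤ r ^ (1 / 4 : ℝ) := Real.rpow_nonneg hr0 _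
  have hvp := abs_le.1 (h2 p hp)
  have hvq := abs_le.1 (h2 q hq)
  have hsq := sq_nonneg (p.2 - y0)
  have hr4 : r ≤ 1 / 4 := by
    by_contra hlt
    push Not at hlt
    have : (1 / 4 : ℝ) ≤ r ^ (1 / 4 : ℝ) := by
      have t1 : (1 / 4 : ℝ) ^ (1 / 4 : ℝ) ≤ r ^ (1 / 4 : ℝ) :=
        Real.rpow_le_rpow (by norm_num) hlt.le (by norm_num)
      have t2 := Real.rpow_le_rpow_of_exponent_ge' (x := 1 / 4) (by norm_num) (by norm_num)
        (z := 1 / 4) (y := 1) (by norm_num) (by norm_num)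
      rw [Real.rpow_one] at t2
      exact t2.trans t1
    linarith
  have hpy : |p.2 - y0| ≤ 1 / 4 := by
    apply abs_le_of_sq_le_sq _ (by norm_num)
    linarith
  have hyr : |p.2 - q.2| ≤ 1 / 4 := by
    refine le_trans ?_ hr4
    exact Real.abs_le_sqrt (by nlinarith [sq_nonneg (p.1 - q.1)])
  have hp2 : |p.2| ≤ 3 / 2 := by
    rw [abs_le] at *; constructor <;> linarith
  have hq2 : |q.2| ≤ 3 / 2 := by
    rw [abs_le] at *; constructor <;> linarith
  have hqF : q ∉ Fset σ := by
    intro h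
    have := decay hσ hS' h hq2 hp
    rw [h3 q h] at hpos
    linarith
  have hpF : p ∉ Fset σ := by
    intro h
    have := decay hσ hS'.neg h hp2 hq
    rw [rr_symm] at this
    rw [h3 p h] at hpos
    linarith
  have hpO := mem_Om hp hpF (by linarith)
  have hqO := mem_Om hq hqF (by linarith)
  have hrpos : 0 < r := by
    rcases hr0.lt_or_eq with h | h
    · exact h
    · exfalso
      have e := rr_sq (p.1 - q.1) (p.2 - q.2)
      rw [← hr, ← h] at e
      have e1 : p.1 = q.1 := by nlinarith [sq_nonneg (p.1 - q.1), sq_nonneg (p.2 - q.2)]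
      have e2 : p.2 = q.2 := by nlinarith [sq_nonneg (p.1 - q.1), sq_nonneg (p.2 - q.2)]
      have : p = q := Prod.ext e1 e2
      have hv : v p = v q := by rw [this]
      linarith
  obtain ⟨m, hm⟩ := D2_expand v (h4 p hpO)
  obtain ⟨n, hn⟩ := D2_expand v (h4 q hqO)
  set c := (p.1 - q.1) / r with hcdef
  set d := (p.2 - q.2) / r with hddef
  have hc1 : p.1 - q.1 = r * c := by rw [hcdef]; field_simp
  have hd1 : p.2 - q.2 = r * d := by rw [hddef]; field_simp
  have hcd : c ^ 2 + d ^ 2 = 1 := by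
    have e := rr_sq (p.1 - q.1) (p.2 - q.2)
    rw [← hr, hc1, hd1] at e
    have : r ^ 2 * (c ^ 2 + d ^ 2 - 1) = 0 := by linarith
    rcases mul_eq_zero.1 this with h | h
    · exact absurd h (by positivity)
    · linarith
  -- derivative of the localising term
  have loc : ∀ k : ℝ, (∀ t : ℝ, HasDerivAt (fun t : ℝ => 32 * (p.2 + t * k - y0) ^ 2)
      (64 * k * (p.2 + t * k - y0)) t) ∧
      HasDerivAt (fun t : ℝ => 64 * k * (p.2 + t * k - y0)) (64 * k ^ 2) 0 := by
    intro k
    have l : ∀ t : ℝ, HasDerivAt (fun t : ℝ => p.2 + t * k - y0) k t := by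
      intro t
      simpa using (((hasDerivAt_id t).mul_const k).const_add p.2).sub_const y0
    constructor
    · intro t
      refine (((l t).pow 2).const_mul 32).congr_deriv ?_
      norm_num; ring
    · refine ((l 0).const_mul (64 * k)).congr_deriv ?_
      ring
  have d1 : D2 v p (c, d) - D2 v q (-c, -d) + 1500 * r ^ (-7 / 4 : ℝ) - 64 * d ^ 2 ≤ 0 := by
    obtain ⟨l1, l2⟩ := line_deriv (h4 p hpO) (c, d)
    obtain ⟨m1, m2⟩ := line_deriv (h4 q hqO) (-c, -d)
    obtain ⟨n1, n2⟩ := loc d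
    have hev : ∀ᶠ t in nhds (0:ℝ), 0 < r + 2 * t := by
      have : Continuous fun t : ℝ => r + 2 * t := by fun_prop
      exact this.continuousAt.eventually (lt_mem_nhds (by simpa using hrpos))
    have lin : ∀ t : ℝ, HasDerivAt (fun t : ℝ => r + 2 * t) 2 t := by
      intro t
      simpa using ((hasDerivAt_id t).const_mul 2).const_add r
    apply sec_nonpos (g := fun t => v (p + t • (c, d)) - v (q + t • (-c, -d)) -
        2000 * (r + 2 * t) ^ (1 / 4 : ℝ) - 32 * (p.2 + t * d - y0) ^ 2)
      (g' := fun t => fderiv ℝ v (p + t • (c, d)) (c, d) - fderiv ℝ v (q + t • (-c, -d)) (-c, -d) -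
        1000 * (r + 2 * t) ^ (-3 / 4 : ℝ) - 64 * d * (p.2 + t * d - y0))
    · filter_upwards [l1, m1, hev] with t a1 a2 a3
      refine ((a1.sub a2).sub ?_).sub (n1 t)
      refine (((lin t).rpow_const (p := (1 / 4 : ℝ)) (Or.inl a3.ne')).const_mul 2000).congr_deriv ?_
      norm_num; ring
    · have k : HasDerivAt (fun t : ℝ => 1000 * (r + 2 * t) ^ (-3 / 4 : ℝ))
          (- (1500 * r ^ (-7 / 4 : ℝ))) 0 := by
        refine (((lin 0).rpow_const (p := (-3 / 4 : ℝ))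
          (Or.inl (by simpa using hrpos.ne'))).const_mul 1000).congr_deriv ?_
        norm_num; ring
      refine (((l2.sub m2).sub k).sub n2).congr_deriv ?_
      ring
    · filter_upwards [Om_line hpO (c, d), Om_line hqO (-c, -d), hev] with t a1 a2 a3
      have := hmax' _ a1 _ a2
      have e : rr ((p + t • ((c, d) : ℝ × ℝ)).1 - (q + t • ((-c, -d) : ℝ × ℝ)).1)
          ((p + t • ((c, d) : ℝ × ℝ)).2 - (q + t • ((-c, -d) : ℝ × ℝ)).2) = r + 2 * t := by
        unfold rr
        rw [Real.sqrt_eq_iff_mul_self_eq (by positivity) a3.le]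
        have e1 : (p + t • ((c, d) : ℝ × ℝ)).1 - (q + t • ((-c, -d) : ℝ × ℝ)).1 =
            (r + 2 * t) * c := by simp; linear_combination hc1
        have e2 : (p + t • ((c, d) : ℝ × ℝ)).2 - (q + t • ((-c, -d) : ℝ × ℝ)).2 =
            (r + 2 * t) * d := by simp; linear_combination hd1
        rw [e1, e2]
        linear_combination (r + 2 * t) ^ 2 * hcd
      rw [e] at this
      simpa using this
  have d2 : D2 v p (-d, c) - D2 v q (-d, c) - 64 * c ^ 2 ≤ 0 := by
    obtain ⟨l1, l2⟩ := line_deriv (h4 p hpO) (-d, c)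
    obtain ⟨m1, m2⟩ := line_deriv (h4 q hqO) (-d, c)
    obtain ⟨n1, n2⟩ := loc c
    apply sec_nonpos (g := fun t => v (p + t • (-d, c)) - v (q + t • (-d, c)) -
        2000 * r ^ (1 / 4 : ℝ) - 32 * (p.2 + t * c - y0) ^ 2)
      (g' := fun t => fderiv ℝ v (p + t • (-d, c)) (-d, c) - fderiv ℝ v (q + t • (-d, c)) (-d, c) -
        64 * c * (p.2 + t * c - y0))
    · filter_upwards [l1, m1] with t a1 a2
      exact ((a1.sub a2).sub_const _).sub (n1 t)
    · exact (l2.sub m2).sub n2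
    · filter_upwards [Om_line hpO (-d, c), Om_line hqO (-d, c)] with t a1 a2
      have := hmax' _ a1 _ a2
      have e : rr ((p + t • ((-d, c) : ℝ × ℝ)).1 - (q + t • ((-d, c) : ℝ × ℝ)).1)
          ((p + t • ((-d, c) : ℝ × ℝ)).2 - (q + t • ((-d, c) : ℝ × ℝ)).2) = r := by
        rw [hr]
        congr 1 <;> simp
      rw [e] at this
      simpa using this
  rw [hm, hn] at d1 d2
  have hbig : 1 ≤ r ^ (-7 / 4 : ℝ) :=
    Real.one_le_rpow_of_pos_of_le_one_of_nonpos hrpos (by linarith) (by norm_num)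
  have E1 := h5 p hpO
  have E2 := h5 q hqO
  have s1 : (c ^ 2 + d ^ 2) * (pdx (pdx v) p + pdy (pdy v) p) = - v p := by
    rw [hcd]; linarith
  have s2 : (c ^ 2 + d ^ 2) * (pdx (pdx v) q + pdy (pdy v) q) = - v q := by
    rw [hcd]; linarith
  nlinarith

/-- **Uniform Hölder estimate (3.12).** There are `α ∈ (0,1)` and `C > 0`, independent of
the slit length `σ`, such that any `|v| ≤ 1` vanishing on `F` and solving `Δv + v = 0` on
`((0,π) × (-2,2)) \ F` is `α`-Hölder on `[0, π] × [-1, 1]` with constant `C`. -/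
theorem uniform_holder_bound :
    ∃ α : ℝ, 0 < α ∧ α < 1 ∧ ∃ C : ℝ, 0 < C ∧
      ∀ σ ∈ Set.Icc (0 : ℝ) π, ∀ v : ℝ × ℝ → ℝ,
        ContinuousOn v (Set.Icc (0 : ℝ) π ×ˢ Set.Icc (-2 : ℝ) 2) →
        (∀ p ∈ Set.Icc (0 : ℝ) π ×ˢ Set.Icc (-2 : ℝ) 2, |v p| ≤ 1) →
        (∀ p ∈ Fset σ, v p = 0) →
        ContDiffOn ℝ 2 v ((Set.Ioo (0 : ℝ) π ×ˢ Set.Ioo (-2 : ℝ) 2) \ Fset σ) →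
        (∀ p ∈ (Set.Ioo (0 : ℝ) π ×ˢ Set.Ioo (-2 : ℝ) 2) \ Fset σ,
          pdx (pdx v) p + pdy (pdy v) p + v p = 0) →
        ∀ p ∈ Set.Icc (0 : ℝ) π ×ˢ Set.Icc (-1 : ℝ) 1,
        ∀ q ∈ Set.Icc (0 : ℝ) π ×ˢ Set.Icc (-1 : ℝ) 1,
          |v p - v q| ≤ C * Real.sqrt ((p.1 - q.1) ^ 2 + (p.2 - q.2) ^ 2) ^ α := by
  refine ⟨1 / 4, by norm_num, by norm_num, 2000, by norm_num, ?_⟩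
  intro σ hσ v h1 h2 h3 h4 h5
  have hS : Sol σ v := ⟨h1, h2, h3, fun p hp => h4.contDiffAt ((Om_open σ).mem_nhds hp), h5⟩
  have hsub : ∀ p ∈ Set.Icc (0 : ℝ) π ×ˢ Set.Icc (-1 : ℝ) 1, p ∈ Rect ∧ |p.2| ≤ 1 := by
    rintro p ⟨a, b, c⟩
    exact ⟨⟨a, by linarith, by linarith⟩, abs_le.2 ⟨b, c⟩⟩
  intro p hp q hq
  obtain ⟨hp1, hp2⟩ := hsub p hp
  obtain ⟨hq1, hq2⟩ := hsub q hq
  have A := doubling hσ hS hp2 p hp1 q hq1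
  have B := doubling hσ hS hq2 q hq1 p hp1
  rw [rr_symm] at B
  change |v p - v q| ≤ 2000 * rr (p.1 - q.1) (p.2 - q.2) ^ (1 / 4 : ℝ)
  rw [abs_le]
  constructor <;> nlinarith
end
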